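/- arXiv:0910.3344 — 2 statements merged into one kernel-verified Lean document; each statement's English description precedes it below -/
import Mathlib

section
/- Let α, β, γ ∈ ℂ with α + β + γ = 0 and Re α = Re β = Re γ = 0, let σ > 0, set μ = (β−γ)/2, and for n ∈ ℕ and y > 0 define Iₙ(y) = (1/(2π))·∫_{−∞}^{∞} [Γ((σ+it−3α/2)/2)·Γ((σ+it−β−α/2)/2)·Γ((σ+it−γ−α/2)/2) / Γ((σ+it−3α/2)/2 − n)] · (πy)^{−σ−it} dt. Then for all n ∈ ℕ and y > 0, Iₙ(y) = (−2)^{−n}·( Pₙ(y)·K_μ(2πy) + 2πy·Qₙ(y)·K_μ′(2πy) ), where Pₙ, Qₙ are defined recursively by P₀(y) = 4, Q₀(y) = 0, and with aₙ = 3α/2 + 2n + 2: P_{n+1}(y) = y·Pₙ′(y) + ((2πy)² + μ²)·Qₙ(y) + aₙ·Pₙ(y), Q_{n+1}(y) = Pₙ(y) + y·Qₙ′(y) + aₙ·Qₙ(y). -/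
open MeasureTheory Real Set

/-- The modified Bessel function of the second kind `K_μ(x)`, defined for `x > 0` by
`K_μ(x) = ∫₀^∞ exp(−x·cosh t)·cosh(μt) dt`. -/
noncomputable def besselK (μ : ℂ) (x : ℝ) : ℂ :=
  ∫ t in Ioi (0 : ℝ), Complex.exp (-(x : ℂ) * Real.cosh t) * Complex.cosh (μ * t)

/-- The Barnes-type integral `Iₙ(y)` appearing in the power series expansion of Jacquet's
Whittaker function for a small argument. -/
noncomputable def barnesI (α β γ : ℂ) (σ : ℝ) (n : ℕ) (y : ℝ) : ℂ :=
  (1 / (2 * π)) * ∫ t : ℝ,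
    Complex.Gamma ((((σ : ℂ) + Complex.I * t) - 3 * α / 2) / 2)
      * Complex.Gamma ((((σ : ℂ) + Complex.I * t) - β - α / 2) / 2)
      * Complex.Gamma ((((σ : ℂ) + Complex.I * t) - γ - α / 2) / 2)
      / Complex.Gamma ((((σ : ℂ) + Complex.I * t) - 3 * α / 2) / 2 - n)
      * ((π * y : ℝ) : ℂ) ^ (-(σ : ℂ) - Complex.I * t)

/-- The pair of polynomials `(Pₙ, Qₙ)` defined by `P₀ = 4`, `Q₀ = 0` and, with
`aₙ = 3α/2 + 2n + 2`: `P_{n+1} = y·Pₙ′ + ((2πy)² + μ²)·Qₙ + aₙ·Pₙ`,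
`Q_{n+1} = Pₙ + y·Qₙ′ + aₙ·Qₙ`. -/
noncomputable def polyPQ (μ α : ℂ) : ℕ → Polynomial ℂ × Polynomial ℂ
  | 0 => (Polynomial.C 4, 0)
  | n + 1 =>
      let p := (polyPQ μ α n).1
      let q := (polyPQ μ α n).2
      let a : ℂ := 3 * α / 2 + 2 * n + 2
      (Polynomial.X * Polynomial.derivative p
          + (Polynomial.C (((2 * π : ℝ) : ℂ) ^ 2) * Polynomial.X ^ 2
              + Polynomial.C (μ ^ 2)) * q
          + Polynomial.C a * p,
        p + Polynomial.X * Polynomial.derivative q + Polynomial.C a * q)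


theorem norm_Gamma_le_Gamma_re {w : ℂ} (hw : 0 < w.re) :
    ‖Complex.Gamma w‖ ≤ Real.Gamma w.re := by
  rw [Complex.Gamma_eq_integral hw, Real.Gamma_eq_integral hw, Complex.GammaIntegral]
  refine (norm_integral_le_integral_norm _).trans_eq ?_
  refine setIntegral_congr_fun measurableSet_Ioi fun x hx => ?_
  simp only [norm_mul, Complex.norm_cpow_eq_rpow_re_of_pos (mem_Ioi.mp hx), Complex.norm_real,
    Real.norm_eq_abs, Real.abs_exp, Complex.sub_re, Complex.one_re]

theorem exists_norm_pow_mul_Gamma_le (k : ℕ) : ∀ {c : ℝ}, 0 < c →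
    ∃ C : ℝ, ∀ w : ℂ, w.re = c → ‖w ^ k * Complex.Gamma w‖ ≤ C := by
  induction k with
  | zero =>
    intro c hc
    refine ⟨Real.Gamma c, fun w hw => ?_⟩
    simpa [hw] using norm_Gamma_le_Gamma_re (hw ▸ hc : 0 < w.re)
  | succ k ih =>
    intro c hc
    obtain ⟨C, hC⟩ := ih (show 0 < c + 1 by linarith)
    refine ⟨C, fun w hw => le_trans ?_ (hC (w + 1) (by simp [hw]))⟩
    have hw0 : w ≠ 0 := fun h => by simp [h] at hw; linarith
    have hle : ‖w‖ ≤ ‖w + 1‖ := by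
      rw [← sq_le_sq₀ (norm_nonneg _) (norm_nonneg _), Complex.sq_norm, Complex.sq_norm,
        Complex.normSq_apply, Complex.normSq_apply]
      simp only [Complex.add_re, Complex.one_re, Complex.add_im, Complex.one_im]
      nlinarith
    rw [Complex.Gamma_add_one w hw0, pow_succ, mul_assoc, norm_mul, norm_mul (_ ^ _), norm_pow,
      norm_pow]
    gcongr

theorem exists_norm_eval_mul_Gamma_le (q : Polynomial ℂ) {c : ℝ} (hc : 0 < c) :
    ∃ C : ℝ, ∀ w : ℂ, w.re = c → ‖q.eval w * Complex.Gamma w‖ ≤ C := by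
  induction q using Polynomial.induction_on' with
  | add p q hp hq =>
    obtain ⟨A, hA⟩ := hp
    obtain ⟨B, hB⟩ := hq
    refine ⟨A + B, fun w hw => ?_⟩
    rw [Polynomial.eval_add, add_mul]
    exact norm_add_le_of_le (hA w hw) (hB w hw)
  | monomial n a =>
    obtain ⟨A, hA⟩ := exists_norm_pow_mul_Gamma_le n hc
    refine ⟨‖a‖ * A, fun w hw => ?_⟩
    rw [Polynomial.eval_monomial, mul_assoc, norm_mul]
    gcongr
    exact hA w hw

/-- The product of Gamma factors `Γ((s-μ)/2) Γ((s+μ)/2)`, a multiple of the Mellin transform of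
`K_μ`. -/
noncomputable def gammaPair (μ s : ℂ) : ℂ :=
  Complex.Gamma ((s - μ) / 2) * Complex.Gamma ((s + μ) / 2)

/-- The Barnes integral of `p(s) Γ((s-μ)/2) Γ((s+μ)/2) u^{-s}` along `Re s = σ`. -/
noncomputable def barnesB (μ : ℂ) (σ : ℝ) (p : Polynomial ℂ) (u : ℝ) : ℂ :=
  ∫ t : ℝ, p.eval (σ + t * Complex.I : ℂ) * gammaPair μ (σ + t * Complex.I)
    * (u : ℂ) ^ (-(σ + t * Complex.I : ℂ))

theorem continuous_gammaPair_vertical {μ : ℂ} (hμ : μ.re = 0) {σ : ℝ} (hσ : 0 < σ) :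
    Continuous fun t : ℝ => gammaPair μ (σ + t * Complex.I) := by
  have key : ∀ ν : ℂ, ν.re = 0 →
      Continuous fun t : ℝ => Complex.Gamma ((σ + t * Complex.I + ν) / 2) := by
    intro ν hν
    rw [continuous_iff_continuousAt]
    intro t
    refine ContinuousAt.comp (f := fun t : ℝ => ((σ + t * Complex.I + ν) / 2 : ℂ))
      (Complex.continuousAt_Gamma _ fun m h => ?_) (by fun_prop)
    have := congrArg Complex.re h
    simp [hν] at this
    have : (0 : ℝ) ≤ m := m.cast_nonneg
    linarith
  have h1 := key (-μ) (by simp [hμ])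
  simp only [← sub_eq_add_neg] at h1
  exact h1.mul (key μ hμ)

theorem integrable_eval_mul_gammaPair {μ : ℂ} (hμ : μ.re = 0) {σ : ℝ} (hσ : 0 < σ)
    (p : Polynomial ℂ) :
    Integrable fun t : ℝ => p.eval (σ + t * Complex.I : ℂ) * gammaPair μ (σ + t * Complex.I) := by
  obtain ⟨A, hA⟩ := exists_norm_eval_mul_Gamma_le
    ((p * (1 - (Polynomial.X - Polynomial.C (σ : ℂ)) ^ 2)).comp
      (2 * Polynomial.X + Polynomial.C μ)) (half_pos hσ)
  obtain ⟨B, hB⟩ := exists_norm_eval_mul_Gamma_le 1 (half_pos hσ)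
  have hcont : Continuous fun t : ℝ => p.eval (σ + t * Complex.I : ℂ) :=
    p.continuous.comp (by fun_prop)
  refine Integrable.mono' (integrable_inv_one_add_sq.const_mul (A * B))
    (hcont.mul (continuous_gammaPair_vertical hμ hσ)).aestronglyMeasurable (ae_of_all _ fun t => ?_)
  have h1 := hA ((σ + t * Complex.I - μ) / 2) (by simp [hμ])
  have h2 := hB ((σ + t * Complex.I + μ) / 2) (by simp [hμ])
  simp only [Polynomial.eval_comp, Polynomial.eval_mul, Polynomial.eval_sub, Polynomial.eval_one,
    Polynomial.eval_pow, Polynomial.eval_X, Polynomial.eval_C, Polynomial.eval_add,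
    Polynomial.eval_ofNat, one_mul] at h1 h2
  have e1 : (2 * ((σ + t * Complex.I - μ) / 2) + μ : ℂ) = σ + t * Complex.I := by ring
  have e2 : (1 - ((σ + t * Complex.I : ℂ) - σ) ^ 2 : ℂ) = ((1 + t ^ 2 : ℝ) : ℂ) := by
    push_cast; ring_nf; simp
  rw [e1, e2] at h1
  have hpos : (0 : ℝ) < 1 + t ^ 2 := by positivity
  rw [← div_eq_mul_inv, le_div_iff₀ hpos]
  calc _ = ‖p.eval (σ + t * Complex.I : ℂ) * ((1 + t ^ 2 : ℝ) : ℂ)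
        * Complex.Gamma ((σ + t * Complex.I - μ) / 2)‖
        * ‖Complex.Gamma ((σ + t * Complex.I + μ) / 2)‖ := by
        simp only [norm_mul, gammaPair, Complex.norm_real, Real.norm_of_nonneg hpos.le]; ring
    _ ≤ A * B := mul_le_mul h1 h2 (norm_nonneg _) ((norm_nonneg _).trans h1)

theorem continuous_cpow_vertical (σ : ℝ) {u : ℝ} (hu : 0 < u) :
    Continuous fun t : ℝ => (u : ℂ) ^ (-(σ + t * Complex.I : ℂ)) :=
  Continuous.const_cpow (by fun_prop) (Or.inl (by exact_mod_cast hu.ne'))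

theorem norm_cpow_vertical (σ t : ℝ) {u : ℝ} (hu : 0 < u) :
    ‖(u : ℂ) ^ (-(σ + t * Complex.I : ℂ))‖ = u ^ (-σ) := by
  rw [Complex.norm_cpow_eq_rpow_re_of_pos hu]; simp

theorem integrable_barnesB {μ : ℂ} (hμ : μ.re = 0) {σ : ℝ} (hσ : 0 < σ) (p : Polynomial ℂ)
    {u : ℝ} (hu : 0 < u) :
    Integrable fun t : ℝ => p.eval (σ + t * Complex.I : ℂ) * gammaPair μ (σ + t * Complex.I)
      * (u : ℂ) ^ (-(σ + t * Complex.I : ℂ)) :=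
  (integrable_eval_mul_gammaPair hμ hσ p).mul_bdd (c := u ^ (-σ))
    (continuous_cpow_vertical σ hu).aestronglyMeasurable
    (ae_of_all _ fun t => (norm_cpow_vertical σ t hu).le)

theorem barnesB_add {μ : ℂ} (hμ : μ.re = 0) {σ : ℝ} (hσ : 0 < σ) (p q : Polynomial ℂ)
    {u : ℝ} (hu : 0 < u) : barnesB μ σ (p + q) u = barnesB μ σ p u + barnesB μ σ q u := by
  rw [barnesB, barnesB, barnesB,
    ← integral_add (integrable_barnesB hμ hσ p hu) (integrable_barnesB hμ hσ q hu)]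
  simp only [Polynomial.eval_add, add_mul]

theorem barnesB_C_mul (μ : ℂ) (σ : ℝ) (c : ℂ) (p : Polynomial ℂ) (u : ℝ) :
    barnesB μ σ (Polynomial.C c * p) u = c * barnesB μ σ p u := by
  rw [barnesB, barnesB, ← integral_const_mul]
  simp only [Polynomial.eval_mul, Polynomial.eval_C, mul_assoc]

theorem hasDerivAt_barnesB {μ : ℂ} (hμ : μ.re = 0) {σ : ℝ} (hσ : 0 < σ) (p : Polynomial ℂ)
    {u : ℝ} (hu : 0 < u) :
    HasDerivAt (barnesB μ σ p) (barnesB μ σ (-Polynomial.X * p) u / u) u := by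
  let F' : ℝ → ℝ → ℂ := fun x t => (-Polynomial.X * p).eval (σ + t * Complex.I : ℂ)
    * gammaPair μ (σ + t * Complex.I) * (x : ℂ) ^ (-(σ + t * Complex.I : ℂ)) / x
  have hmem : ∀ x ∈ Ioi (u / 2), 0 < x := fun x hx => (half_pos hu).trans hx
  have hint := integrable_eval_mul_gammaPair hμ hσ (-Polynomial.X * p)
  have hmeas : ∀ᶠ x : ℝ in nhds u, AEStronglyMeasurable (fun t : ℝ => p.eval (σ + t * Complex.I : ℂ)
      * gammaPair μ (σ + t * Complex.I) * (x : ℂ) ^ (-(σ + t * Complex.I : ℂ))) volume := by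
    filter_upwards [Ioi_mem_nhds hu] with x hx
    exact (integrable_barnesB hμ hσ p hx).aestronglyMeasurable
  have hbound : ∀ t : ℝ, ∀ x ∈ Ioi (u / 2), ‖F' x t‖ ≤
      ‖(-Polynomial.X * p).eval (σ + t * Complex.I : ℂ)
        * gammaPair μ (σ + t * Complex.I)‖ * ((u / 2) ^ (-σ) / (u / 2)) := by
    intro t x hx
    simp only [F']
    rw [norm_div, norm_mul, norm_cpow_vertical σ t (hmem x hx), mul_div_assoc, Complex.norm_real,
      Real.norm_of_nonneg (hmem x hx).le]
    have hux : u / 2 ≤ x := le_of_lt hx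
    have hu2 : 0 < u / 2 := half_pos hu
    have : x ^ (-σ) ≤ (u / 2) ^ (-σ) := Real.rpow_le_rpow_of_nonpos hu2 hux (by linarith)
    gcongr
  have hderiv : ∀ t : ℝ, ∀ x ∈ Ioi (u / 2), HasDerivAt (fun x : ℝ =>
      p.eval (σ + t * Complex.I : ℂ) * gammaPair μ (σ + t * Complex.I)
        * (x : ℂ) ^ (-(σ + t * Complex.I : ℂ))) (F' x t) x := by
    intro t x hx
    have hx0 := hmem x hx
    have hxc : (x : ℂ) ≠ 0 := by exact_mod_cast hx0.ne'
    have h1 := ((hasDerivAt_id (x : ℂ)).cpow_const (c := -(σ + t * Complex.I : ℂ))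
      (Complex.ofReal_mem_slitPlane.mpr hx0)).comp_ofReal
    refine (h1.const_mul (p.eval (σ + t * Complex.I : ℂ)
      * gammaPair μ (σ + t * Complex.I))).congr_deriv ?_
    simp only [F', id, Polynomial.eval_mul, Polynomial.eval_neg, Polynomial.eval_X]
    rw [Complex.cpow_sub _ _ hxc, Complex.cpow_one]
    ring
  have h := (hasDerivAt_integral_of_dominated_loc_of_deriv_le (μ := volume) (x₀ := u)
    (s := Ioi (u / 2)) (F' := F') (Ioi_mem_nhds (by linarith)) hmeas
    (integrable_barnesB hμ hσ p hu)
    ((integrable_barnesB hμ hσ (-Polynomial.X * p) hu).div_const _).aestronglyMeasurable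
    (ae_of_all _ hbound) (hint.norm.mul_const _) (ae_of_all _ hderiv)).2
  refine h.congr_deriv ?_
  rw [barnesB, ← integral_div]

theorem gammaPair_add_two {μ : ℂ} (hμ : μ.re = 0) {s : ℂ} (hs : 0 < s.re) :
    4 * gammaPair μ (s + 2) = (s ^ 2 - μ ^ 2) * gammaPair μ s := by
  have hne : ∀ ν : ℂ, ν.re = 0 → (s + ν) / 2 ≠ 0 := fun ν hν h => by
    have := congrArg Complex.re h
    simp [hν] at this; linarith
  have h1 := Complex.Gamma_add_one _ (hne (-μ) (by simp [hμ]))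
  have h2 := Complex.Gamma_add_one _ (hne μ hμ)
  rw [← sub_eq_add_neg] at h1
  rw [gammaPair, gammaPair, show (s + 2 - μ) / 2 = (s - μ) / 2 + 1 by ring,
    show (s + 2 + μ) / 2 = (s + μ) / 2 + 1 by ring, h1, h2]
  ring

theorem barnesB_X_sq_sub {μ : ℂ} (hμ : μ.re = 0) {σ : ℝ} (hσ : 0 < σ) {u : ℝ} (hu : 0 < u) :
    barnesB μ σ (Polynomial.X ^ 2 - Polynomial.C (μ ^ 2)) u
      = 4 * u ^ 2 * barnesB μ (σ + 2) 1 u := by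
  rw [barnesB, barnesB, ← integral_const_mul]
  refine integral_congr_ae (ae_of_all _ fun t => ?_)
  have huc : (u : ℂ) ≠ 0 := by exact_mod_cast hu.ne'
  have h := gammaPair_add_two hμ (s := σ + t * Complex.I) (by simpa using hσ)
  have e : (((σ + 2 : ℝ) : ℂ) + t * Complex.I) = σ + t * Complex.I + 2 := by push_cast; ring
  simp only [Polynomial.eval_sub, Polynomial.eval_pow, Polynomial.eval_X, Polynomial.eval_C,
    Polynomial.eval_one, one_mul]
  rw [← h, e, neg_add (_ + _) (2 : ℂ), Complex.cpow_add _ _ huc]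
  have h2 : (u : ℂ) ^ (-2 : ℂ) = ((u : ℂ) ^ 2)⁻¹ := by
    rw [Complex.cpow_neg]; norm_cast
  rw [h2]
  field_simp

theorem ofReal_exp_cpow (x : ℝ) (a : ℂ) : ((Real.exp x : ℝ) : ℂ) ^ a = Complex.exp (x * a) := by
  rw [Complex.cpow_def_of_ne_zero (by exact_mod_cast (Real.exp_pos x).ne'), ← Complex.ofReal_log
    (Real.exp_pos x).le, Real.log_exp]

theorem sigmoid_two_mul (t : ℝ) :
    Real.sigmoid (2 * t) = Real.exp (t - Real.log (2 * Real.cosh t)) := by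
  have hc := Real.cosh_pos t
  rw [Real.exp_sub, Real.exp_log (by positivity), Real.sigmoid_def, Real.cosh_eq,
    mul_div_cancel₀ _ two_ne_zero, inv_eq_one_div, div_eq_div_iff (by positivity) (by positivity),
    one_mul, mul_add, mul_one, ← Real.exp_add, show t + -(2 * t) = -t by ring]

theorem one_sub_sigmoid_two_mul (t : ℝ) :
    1 - Real.sigmoid (2 * t) = Real.exp (-t - Real.log (2 * Real.cosh t)) := by
  rw [← Real.sigmoid_neg, show -(2 * t) = 2 * (-t) by ring, sigmoid_two_mul, Real.cosh_neg]

theorem betaIntegrand_sigmoid (a b : ℂ) (t : ℝ) :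
    |2 * (Real.sigmoid (2 * t) * (1 - Real.sigmoid (2 * t)))|
        • ((Real.sigmoid (2 * t) : ℂ) ^ (a - 1) * (1 - (Real.sigmoid (2 * t) : ℂ)) ^ (b - 1))
      = 2 * (Complex.exp ((a - b) * t) * ((2 * Real.cosh t : ℝ) : ℂ) ^ (-(a + b))) := by
  have hc : 0 < 2 * Real.cosh t := by have := Real.cosh_pos t; positivity
  rw [show (1 - (Real.sigmoid (2 * t) : ℂ)) = ((1 - Real.sigmoid (2 * t) : ℝ) : ℂ) by push_cast; rfl,
    one_sub_sigmoid_two_mul, sigmoid_two_mul, abs_of_nonneg (by positivity), ofReal_exp_cpow,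
    ofReal_exp_cpow, ← Real.exp_log hc, ofReal_exp_cpow, Real.exp_log hc, Complex.real_smul]
  push_cast
  rw [mul_assoc, ← Complex.exp_add, ← Complex.exp_add, ← Complex.exp_add, ← Complex.exp_add]
  ring_nf

theorem hasDerivAt_sigmoid_two_mul (t : ℝ) : HasDerivAt (fun t => Real.sigmoid (2 * t))
    (2 * (Real.sigmoid (2 * t) * (1 - Real.sigmoid (2 * t)))) t := by
  have h := (Real.hasDerivAt_sigmoid (2 * t)).comp t ((hasDerivAt_id t).const_mul 2)
  refine h.congr_deriv ?_
  ring

theorem image_sigmoid_two_mul : (fun t => Real.sigmoid (2 * t)) '' univ = Ioo 0 1 := by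
  rw [image_univ, ← Real.range_sigmoid]
  exact (mul_left_surjective₀ (two_ne_zero (α := ℝ))).range_comp Real.sigmoid

theorem injOn_sigmoid_two_mul : InjOn (fun t => Real.sigmoid (2 * t)) univ :=
  fun x _ y _ h => by simpa using Real.sigmoid_injective h

theorem integrable_exp_mul_cosh_cpow {a b : ℂ} (ha : 0 < a.re) (hb : 0 < b.re) :
    Integrable fun t : ℝ =>
      Complex.exp ((a - b) * t) * ((2 * Real.cosh t : ℝ) : ℂ) ^ (-(a + b)) := by
  have h := Complex.betaIntegral_convergent ha hb
  rw [intervalIntegrable_iff_integrableOn_Ioo_of_le zero_le_one, ← image_sigmoid_two_mul,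
    integrableOn_image_iff_integrableOn_abs_deriv_smul MeasurableSet.univ
      (fun t _ => (hasDerivAt_sigmoid_two_mul t).hasDerivWithinAt) injOn_sigmoid_two_mul,
    integrableOn_univ] at h
  simp only [betaIntegrand_sigmoid] at h
  simpa using h.const_mul (1 / 2)

theorem betaIntegral_eq_integral_cosh (a b : ℂ) :
    Complex.betaIntegral a b = 2 * ∫ t : ℝ,
      Complex.exp ((a - b) * t) * ((2 * Real.cosh t : ℝ) : ℂ) ^ (-(a + b)) := by
  rw [Complex.betaIntegral, intervalIntegral.integral_of_le zero_le_one,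
    integral_Ioc_eq_integral_Ioo, ← image_sigmoid_two_mul,
    integral_image_eq_integral_abs_deriv_smul MeasurableSet.univ
      (fun t _ => (hasDerivAt_sigmoid_two_mul t).hasDerivWithinAt) injOn_sigmoid_two_mul,
    setIntegral_univ]
  simp only [betaIntegrand_sigmoid]
  rw [integral_const_mul]

theorem integrable_cosh_mul_cosh_cpow {μ s : ℂ} (hμ : μ.re = 0) (hs : 0 < s.re) :
    Integrable fun t : ℝ => Complex.cosh (μ * t) * ((2 * Real.cosh t : ℝ) : ℂ) ^ (-s) := by
  have h1 := integrable_exp_mul_cosh_cpow (a := (s + μ) / 2) (b := (s - μ) / 2)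
    (by simpa [hμ] using hs) (by simpa [hμ] using hs)
  have h2 := integrable_exp_mul_cosh_cpow (a := (s - μ) / 2) (b := (s + μ) / 2)
    (by simpa [hμ] using hs) (by simpa [hμ] using hs)
  refine ((h1.add h2).div_const 2).congr (ae_of_all _ fun t => ?_)
  simp only [Pi.add_apply, Complex.cosh]
  ring_nf

theorem integral_cosh_mul_cosh_cpow {μ s : ℂ} (hμ : μ.re = 0) (hs : 0 < s.re) :
    Complex.Gamma s * ∫ t : ℝ, Complex.cosh (μ * t) * ((2 * Real.cosh t : ℝ) : ℂ) ^ (-s)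
      = gammaPair μ s / 2 := by
  have ha : 0 < ((s + μ) / 2).re := by simpa [hμ] using hs
  have hb : 0 < ((s - μ) / 2).re := by simpa [hμ] using hs
  have h1 := integrable_exp_mul_cosh_cpow ha hb
  have h2 := integrable_exp_mul_cosh_cpow hb ha
  have e1 := Complex.Gamma_mul_Gamma_eq_betaIntegral ha hb
  have e2 := Complex.Gamma_mul_Gamma_eq_betaIntegral hb ha
  rw [betaIntegral_eq_integral_cosh, show (s + μ) / 2 + (s - μ) / 2 = s by ring,
    show (s + μ) / 2 - (s - μ) / 2 = μ by ring] at e1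
  rw [betaIntegral_eq_integral_cosh, show (s - μ) / 2 + (s + μ) / 2 = s by ring,
    show (s - μ) / 2 - (s + μ) / 2 = -μ by ring] at e2
  rw [show (s + μ) / 2 + (s - μ) / 2 = s by ring,
    show (s + μ) / 2 - (s - μ) / 2 = μ by ring] at h1
  rw [show (s - μ) / 2 + (s + μ) / 2 = s by ring,
    show (s - μ) / 2 - (s + μ) / 2 = -μ by ring] at h2
  have e3 : ∫ t : ℝ, Complex.cosh (μ * t) * ((2 * Real.cosh t : ℝ) : ℂ) ^ (-s)
      = ((∫ t : ℝ, Complex.exp (μ * t) * ((2 * Real.cosh t : ℝ) : ℂ) ^ (-s))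
        + ∫ t : ℝ, Complex.exp (-μ * t) * ((2 * Real.cosh t : ℝ) : ℂ) ^ (-s)) / 2 := by
    rw [← integral_add h1 h2, ← integral_div]
    refine integral_congr_ae (ae_of_all _ fun t => ?_)
    simp only [Complex.cosh, neg_mul]
    ring
  rw [e3, gammaPair]
  linear_combination (-1 / 4) * e1 - (1 / 4) * e2

theorem integral_eq_two_mul_integral_Ioi_of_even {f : ℝ → ℂ} (hf : Integrable f)
    (h : ∀ t, f (-t) = f t) : ∫ t, f t = 2 * ∫ t in Ioi 0, f t := by
  have e := integral_comp_neg_Ioi 0 f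
  simp only [h, neg_zero] at e
  rw [← intervalIntegral.integral_Iic_add_Ioi (b := 0) hf.integrableOn hf.integrableOn, ← e]
  ring

theorem sq_div_four_le_cosh (t : ℝ) : t ^ 2 / 4 ≤ Real.cosh t := by
  rw [← Real.cosh_abs, Real.cosh_eq]
  have h1 := Real.quadratic_le_exp_of_nonneg (abs_nonneg t)
  have h2 := Real.exp_pos (-|t|)
  have h3 := abs_nonneg t
  rw [sq_abs] at h1
  linarith

theorem integrable_exp_neg_mul_cosh {c : ℝ} (hc : 0 < c) :
    Integrable fun t : ℝ => Real.exp (-c * Real.cosh t) := by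
  refine (integrable_exp_neg_mul_sq (show 0 < c / 4 by positivity)).mono'
    (by fun_prop) (ae_of_all _ fun t => ?_)
  rw [Real.norm_of_nonneg (Real.exp_pos _).le, Real.exp_le_exp]
  nlinarith [sq_div_four_le_cosh t]

theorem norm_cosh_le_one {μ : ℂ} (hμ : μ.re = 0) (t : ℝ) : ‖Complex.cosh (μ * t)‖ ≤ 1 := by
  have h : μ = (μ.im : ℂ) * Complex.I := by apply Complex.ext <;> simp [hμ]
  rw [h, mul_right_comm, Complex.cosh_mul_I, ← Complex.ofReal_mul, ← Complex.ofReal_cos,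
    Complex.norm_real]
  exact Real.abs_cos_le_one _

theorem norm_besselK_integrand_le {μ : ℂ} (hμ : μ.re = 0) (x t : ℝ) :
    ‖Complex.exp (-(x : ℂ) * Real.cosh t) * Complex.cosh (μ * t)‖
      ≤ Real.exp (-x * Real.cosh t) := by
  rw [norm_mul, Complex.norm_exp, ← Complex.ofReal_neg, ← Complex.ofReal_mul, Complex.ofReal_re]
  exact mul_le_of_le_one_right (Real.exp_pos _).le (norm_cosh_le_one hμ t)

theorem integrable_besselK_integrand {μ : ℂ} (hμ : μ.re = 0) {x : ℝ} (hx : 0 < x) :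
    Integrable fun t : ℝ => Complex.exp (-(x : ℂ) * Real.cosh t) * Complex.cosh (μ * t) :=
  (integrable_exp_neg_mul_cosh hx).mono' (by fun_prop)
    (ae_of_all _ fun t => norm_besselK_integrand_le hμ x t)

theorem two_mul_besselK {μ : ℂ} (hμ : μ.re = 0) {x : ℝ} (hx : 0 < x) :
    2 * besselK μ x
      = ∫ t : ℝ, Complex.exp (-(x : ℂ) * Real.cosh t) * Complex.cosh (μ * t) :=
  (integral_eq_two_mul_integral_Ioi_of_even (integrable_besselK_integrand hμ hx)
    fun t => by simp).symm

theorem continuousAt_besselK {μ : ℂ} (hμ : μ.re = 0) {x : ℝ} (hx : 0 < x) :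
    ContinuousAt (besselK μ) x := by
  refine continuousAt_of_dominated (bound := fun t => Real.exp (-(x / 2) * Real.cosh t))
    (Filter.Eventually.of_forall fun y => (by fun_prop)) ?_
    (integrable_exp_neg_mul_cosh (half_pos hx)).integrableOn
    (ae_of_all _ fun t => by fun_prop)
  filter_upwards [Ioi_mem_nhds (show x / 2 < x by linarith)] with y hy
  refine ae_of_all _ fun t => (norm_besselK_integrand_le hμ y t).trans (Real.exp_le_exp.mpr ?_)
  have := Real.cosh_pos t
  have := mem_Ioi.mp hy
  nlinarith

theorem integral_cpow_mul_besselK_integrand (μ : ℂ) {s : ℂ} (hs : 0 < s.re) (t : ℝ) :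
    (IntegrableOn (fun u : ℝ => (u : ℂ) ^ (s - 1)
      * (Complex.exp (-((2 * u : ℝ) : ℂ) * Real.cosh t) * Complex.cosh (μ * t))) (Ioi 0)) ∧
    ∫ u in Ioi (0 : ℝ), (u : ℂ) ^ (s - 1)
      * (Complex.exp (-((2 * u : ℝ) : ℂ) * Real.cosh t) * Complex.cosh (μ * t))
      = Complex.Gamma s * (Complex.cosh (μ * t) * ((2 * Real.cosh t : ℝ) : ℂ) ^ (-s)) := by
  have hc : 0 < 2 * Real.cosh t := by have := Real.cosh_pos t; positivity
  have hcc : ((2 * Real.cosh t : ℝ) : ℂ) ≠ 0 := by exact_mod_cast hc.ne'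
  have h := Complex.integral_cpow_mul_exp_neg_mul_Ioi hs hc
  rw [one_div, Complex.inv_cpow _ _ (by
    rw [Complex.arg_ofReal_of_nonneg hc.le]; exact Real.pi_pos.ne), ← Complex.cpow_neg] at h
  have hint := Integrable.of_integral_ne_zero (h.trans_ne (mul_ne_zero
    (by rw [Complex.cpow_def_of_ne_zero hcc]; exact Complex.exp_ne_zero _)
    (Complex.Gamma_ne_zero_of_re_pos hs)))
  have e : ∀ u : ℝ, (u : ℂ) ^ (s - 1)
      * (Complex.exp (-((2 * u : ℝ) : ℂ) * Real.cosh t) * Complex.cosh (μ * t))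
      = (u : ℂ) ^ (s - 1) * Complex.exp (-(((2 * Real.cosh t : ℝ) : ℂ) * u))
        * Complex.cosh (μ * t) := fun u => by push_cast; ring_nf
  simp only [e]
  refine ⟨hint.mul_const _, ?_⟩
  rw [integral_mul_const, h]
  ring

theorem integrable_cpow_mul_besselK_integrand {μ s : ℂ} (hμ : μ.re = 0) (hs : 0 < s.re) :
    Integrable (Function.uncurry fun u t : ℝ => (u : ℂ) ^ (s - 1)
      * (Complex.exp (-((2 * u : ℝ) : ℂ) * Real.cosh t) * Complex.cosh (μ * t)))
      ((volume.restrict (Ioi 0)).prod volume) := by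
  have hmeas : Measurable (Function.uncurry fun u t : ℝ => (u : ℂ) ^ (s - 1)
      * (Complex.exp (-((2 * u : ℝ) : ℂ) * Real.cosh t) * Complex.cosh (μ * t))) := by
    unfold Function.uncurry
    fun_prop
  rw [integrable_prod_iff' hmeas.aestronglyMeasurable]
  refine ⟨ae_of_all _ fun t => (integral_cpow_mul_besselK_integrand μ hs t).1, ?_⟩
  refine ((integrable_cosh_mul_cosh_cpow hμ hs).norm.const_mul (Real.Gamma s.re)).congr
    (ae_of_all _ fun t => ?_)
  have hc : 0 < 2 * Real.cosh t := by have := Real.cosh_pos t; positivity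
  have h := Real.integral_rpow_mul_exp_neg_mul_Ioi hs hc
  rw [one_div, Real.inv_rpow hc.le, ← Real.rpow_neg hc.le] at h
  have e : ∫ u in Ioi (0 : ℝ), ‖(u : ℂ) ^ (s - 1)
      * (Complex.exp (-((2 * u : ℝ) : ℂ) * Real.cosh t) * Complex.cosh (μ * t))‖
      = ∫ u in Ioi (0 : ℝ), u ^ (s.re - 1) * Real.exp (-(2 * Real.cosh t * u))
        * ‖Complex.cosh (μ * t)‖ := by
    refine setIntegral_congr_fun measurableSet_Ioi fun u hu => ?_
    simp only [norm_mul, Complex.norm_cpow_eq_rpow_re_of_pos (mem_Ioi.mp hu), Complex.norm_exp,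
      Complex.sub_re, Complex.one_re, ← Complex.ofReal_neg, ← Complex.ofReal_mul,
      Complex.ofReal_re]
    ring_nf
  simp only [Function.uncurry_apply_pair]
  rw [e, integral_mul_const, h, norm_mul, Complex.norm_cpow_eq_rpow_re_of_pos hc, Complex.neg_re]
  ring

theorem hasMellin_besselK_two_mul {μ s : ℂ} (hμ : μ.re = 0) (hs : 0 < s.re) :
    HasMellin (fun u => besselK μ (2 * u)) s (gammaPair μ s / 4) := by
  have hint := integrable_cpow_mul_besselK_integrand hμ hs
  have e : EqOn (fun u : ℝ => (1 / 2 : ℂ) * ∫ t : ℝ, (u : ℂ) ^ (s - 1)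
      * (Complex.exp (-((2 * u : ℝ) : ℂ) * Real.cosh t) * Complex.cosh (μ * t)))
      (fun u : ℝ => (u : ℂ) ^ (s - 1) • besselK μ (2 * u)) (Ioi 0) := fun u hu => by
    have h := two_mul_besselK hμ (mul_pos two_pos (mem_Ioi.mp hu))
    simp only [smul_eq_mul]
    rw [integral_const_mul, ← h]
    ring
  refine ⟨(integrableOn_congr_fun e measurableSet_Ioi).mp
    (hint.integral_prod_left.const_mul (1 / 2)), ?_⟩
  rw [mellin, ← setIntegral_congr_fun measurableSet_Ioi e, integral_const_mul,
    integral_integral_swap hint]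
  simp only [fun t => (integral_cpow_mul_besselK_integrand μ hs t).2]
  rw [integral_const_mul, integral_cosh_mul_cosh_cpow hμ hs]
  ring

theorem barnesB_one {μ : ℂ} (hμ : μ.re = 0) {σ : ℝ} (hσ : 0 < σ) {u : ℝ} (hu : 0 < u) :
    barnesB μ σ 1 u = 8 * π * besselK μ (2 * u) := by
  have hm : ∀ t : ℝ, mellin (fun u => besselK μ (2 * u)) (σ + t * Complex.I)
      = gammaPair μ (σ + t * Complex.I) / 4 := fun t =>
    (hasMellin_besselK_two_mul hμ (by simpa using hσ)).2
  have hv : Complex.VerticalIntegrable (mellin fun u => besselK μ (2 * u)) σ := by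
    simp only [Complex.VerticalIntegrable, hm]
    simpa using (integrable_eval_mul_gammaPair hμ hσ 1).div_const 4
  have h := mellinInv_mellin_eq σ (fun u => besselK μ (2 * u)) hu
    (hasMellin_besselK_two_mul hμ (by simpa using hσ)).1 hv
    (ContinuousAt.comp (f := fun u : ℝ => 2 * u) (continuousAt_besselK hμ (by positivity))
      (by fun_prop))
  simp only [mellinInv, hm] at h
  rw [← h, barnesB]
  have hpi : (π : ℂ) ≠ 0 := by exact_mod_cast Real.pi_ne_zero
  have e : ∀ t : ℝ, Polynomial.eval (σ + t * Complex.I : ℂ) 1 * gammaPair μ (σ + t * Complex.I)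
      * (u : ℂ) ^ (-(σ + t * Complex.I : ℂ))
      = 4 * ((u : ℂ) ^ (-(σ + t * Complex.I : ℂ)) • (gammaPair μ (σ + t * Complex.I) / 4)) :=
    fun t => by simp only [Polynomial.eval_one, smul_eq_mul]; ring
  simp only [e]
  rw [integral_const_mul, Complex.real_smul]
  generalize (∫ t : ℝ, (u : ℂ) ^ (-(σ + t * Complex.I : ℂ))
    • (gammaPair μ (σ + t * Complex.I) / 4)) = J
  push_cast
  field_simp
  ring

theorem besselK_eq_barnesB {μ : ℂ} (hμ : μ.re = 0) {σ : ℝ} (hσ : 0 < σ) {x : ℝ} (hx : 0 < x) :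
    besselK μ x = (8 * π : ℂ)⁻¹ * barnesB μ σ 1 (x / 2) := by
  have hpi : (π : ℂ) ≠ 0 := by exact_mod_cast Real.pi_ne_zero
  rw [barnesB_one hμ hσ (half_pos hx), mul_div_cancel₀ _ two_ne_zero]
  field_simp

theorem hasDerivAt_barnesB_half {μ : ℂ} (hμ : μ.re = 0) {σ : ℝ} (hσ : 0 < σ)
    (p : Polynomial ℂ) {x : ℝ} (hx : 0 < x) :
    HasDerivAt (fun x => barnesB μ σ p (x / 2))
      (barnesB μ σ (-Polynomial.X * p) (x / 2) / x) x := by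
  have h := (hasDerivAt_barnesB hμ hσ p (half_pos hx)).scomp x ((hasDerivAt_id x).div_const 2)
  refine h.congr_deriv ?_
  have hxc : (x : ℂ) ≠ 0 := by exact_mod_cast hx.ne'
  simp only [Complex.real_smul]
  push_cast
  field_simp

theorem hasDerivAt_besselK {μ : ℂ} (hμ : μ.re = 0) {σ : ℝ} (hσ : 0 < σ) {x : ℝ} (hx : 0 < x) :
    HasDerivAt (besselK μ) ((8 * π : ℂ)⁻¹ * (barnesB μ σ (-Polynomial.X) (x / 2) / x)) x := by
  have h := (hasDerivAt_barnesB_half hμ hσ 1 hx).const_mul ((8 * π)⁻¹ : ℂ)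
  rw [mul_one] at h
  refine h.congr_of_eventuallyEq ?_
  filter_upwards [Ioi_mem_nhds hx] with y hy using besselK_eq_barnesB hμ hσ hy

/-- The modified Bessel equation `(x d/dx)² K_μ = (x² + μ²) K_μ`. -/
theorem hasDerivAt_mul_deriv_besselK {μ : ℂ} (hμ : μ.re = 0) {x : ℝ} (hx : 0 < x) :
    HasDerivAt (fun x : ℝ => x * deriv (besselK μ) x)
      ((x ^ 2 + μ ^ 2) * besselK μ x / x) x := by
  have h := (hasDerivAt_barnesB_half hμ one_pos (-Polynomial.X) hx).const_mul ((8 * π)⁻¹ : ℂ)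
  have hxc : (x : ℂ) ≠ 0 := by exact_mod_cast hx.ne'
  have hB : barnesB μ 1 (-Polynomial.X * -Polynomial.X) (x / 2)
      = (8 * π) * ((x ^ 2 + μ ^ 2) * besselK μ x) := by
    have e : (-Polynomial.X * -Polynomial.X : Polynomial ℂ)
        = (Polynomial.X ^ 2 - Polynomial.C (μ ^ 2)) + Polynomial.C (μ ^ 2) * 1 := by ring
    rw [e, barnesB_add hμ one_pos _ _ (half_pos hx), barnesB_C_mul,
      barnesB_X_sq_sub hμ one_pos (half_pos hx), barnesB_one hμ one_pos (half_pos hx),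
      barnesB_one hμ (by norm_num) (half_pos hx), mul_div_cancel₀ _ two_ne_zero]
    push_cast
    ring
  have hpi : (π : ℂ) ≠ 0 := by exact_mod_cast Real.pi_ne_zero
  rw [hB] at h
  refine (h.congr_of_eventuallyEq ?_).congr_deriv (by field_simp)
  filter_upwards [Ioi_mem_nhds hx] with y hy
  have hyc : (y : ℂ) ≠ 0 := by exact_mod_cast (ne_of_gt hy)
  rw [(hasDerivAt_besselK hμ one_pos hy).deriv]
  field_simp

/-- The polynomial `∏_{j<n} ((s - 3α/2)/2 - (j+1))` in `s`. -/
noncomputable def shiftPoly (α : ℂ) : ℕ → Polynomial ℂ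
  | 0 => 1
  | n + 1 => Polynomial.C (-1 / 2) * (-Polynomial.X * shiftPoly α n
      + Polynomial.C (3 * α / 2 + 2 * n + 2) * shiftPoly α n)

theorem eval_shiftPoly {α s : ℂ} (hα : α.re = 0) (hs : 0 < s.re) (n : ℕ) :
    (shiftPoly α n).eval s
      = Complex.Gamma ((s - 3 * α / 2) / 2) * (Complex.Gamma ((s - 3 * α / 2) / 2 - n))⁻¹ := by
  induction n with
  | zero =>
    have h : Complex.Gamma ((s - 3 * α / 2) / 2) ≠ 0 :=
      Complex.Gamma_ne_zero_of_re_pos (by simpa [hα] using hs)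
    simp [shiftPoly, h]
  | succ n ih =>
    have h := Complex.one_div_Gamma_eq_self_mul_one_div_Gamma_add_one
      ((s - 3 * α / 2) / 2 - (n + 1 : ℕ))
    rw [show (s - 3 * α / 2) / 2 - (n + 1 : ℕ) + 1 = (s - 3 * α / 2) / 2 - n by
      push_cast; ring] at h
    rw [h]
    simp only [shiftPoly, Polynomial.eval_mul, Polynomial.eval_add, Polynomial.eval_neg,
      Polynomial.eval_X, Polynomial.eval_C, ih]
    push_cast
    ring

theorem barnesI_eq_barnesB {α β γ : ℂ} (hsum : α + β + γ = 0) (hα : α.re = 0) {σ : ℝ}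
    (hσ : 0 < σ) (n : ℕ) (y : ℝ) :
    barnesI α β γ σ n y
      = (1 / (2 * π)) * barnesB ((β - γ) / 2) σ (shiftPoly α n) (π * y) := by
  rw [barnesI, barnesB]
  congr 1
  refine integral_congr_ae (ae_of_all _ fun t => ?_)
  simp only []
  rw [eval_shiftPoly hα (by simpa using hσ), gammaPair, mul_comm Complex.I (t : ℂ), neg_add',
    show (σ + t * Complex.I : ℂ) - β - α / 2 = σ + t * Complex.I - (β - γ) / 2 by
      linear_combination (-1 / 2) * hsum,
    show (σ + t * Complex.I : ℂ) - γ - α / 2 = σ + t * Complex.I + (β - γ) / 2 by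
      linear_combination (-1 / 2) * hsum]
  ring

theorem barnesB_shiftPoly_eq {μ : ℂ} (hμ : μ.re = 0) (α : ℂ) {σ : ℝ} (hσ : 0 < σ) (n : ℕ) :
    ∀ y : ℝ, 0 < y → (1 / (2 * π)) * barnesB μ σ (shiftPoly α n) (π * y)
      = ((-2 : ℂ) ^ n)⁻¹ * ((polyPQ μ α n).1.eval (y : ℂ) * besselK μ (2 * π * y)
        + (polyPQ μ α n).2.eval (y : ℂ)
          * (((2 * π * y : ℝ) : ℂ) * deriv (besselK μ) (2 * π * y))) := by
  have hpi : (π : ℂ) ≠ 0 := by exact_mod_cast Real.pi_ne_zero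
  induction n with
  | zero =>
    intro y hy
    rw [shiftPoly, barnesB_one hμ hσ (by positivity), ← mul_assoc 2 π y]
    simp only [polyPQ, Polynomial.eval_C, Polynomial.eval_zero]
    field_simp
    ring
  | succ n ih =>
    intro y hy
    have hyc : (y : ℂ) ≠ 0 := by exact_mod_cast hy.ne'
    have hx : 0 < 2 * π * y := by positivity
    have hL : HasDerivAt (fun y : ℝ => (1 / (2 * π)) * barnesB μ σ (shiftPoly α n) (π * y))
        ((1 / (2 * π)) * barnesB μ σ (-Polynomial.X * shiftPoly α n) (π * y) / y) y := by
      have h := ((hasDerivAt_barnesB hμ hσ (shiftPoly α n) (u := π * y) (by positivity)).scomp y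
        ((hasDerivAt_id y).const_mul π)).const_mul (1 / (2 * π) : ℂ)
      refine h.congr_deriv ?_
      simp only [Complex.real_smul]
      push_cast
      field_simp
    have hlin : HasDerivAt (fun y : ℝ => 2 * π * y) (2 * π) y := by
      simpa using (hasDerivAt_id y).const_mul (2 * π)
    have hK := (hasDerivAt_besselK hμ hσ hx).differentiableAt.hasDerivAt.scomp y hlin
    have hK' := (hasDerivAt_mul_deriv_besselK hμ hx).scomp y hlin
    have hP := ((polyPQ μ α n).1.hasDerivAt (y : ℂ)).comp_ofReal
    have hQ := ((polyPQ μ α n).2.hasDerivAt (y : ℂ)).comp_ofReal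
    have hR := ((hP.mul hK).add (hQ.mul hK')).const_mul (((-2 : ℂ) ^ n)⁻¹)
    have hEq := (hL.congr_of_eventuallyEq (by
      filter_upwards [Ioi_mem_nhds hy] with z hz using (ih z hz).symm)).unique hR
    have ihy := ih y hy
    rw [div_eq_iff hyc] at hEq
    rw [shiftPoly, barnesB_C_mul, barnesB_add hμ hσ _ _ (by positivity), barnesB_C_mul]
    simp only [Function.comp_apply, Complex.real_smul] at hEq
    simp only [polyPQ, Polynomial.eval_add, Polynomial.eval_mul, Polynomial.eval_X,
      Polynomial.eval_C, Polynomial.eval_pow]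
    have hpow : ((-2 : ℂ) ^ (n + 1))⁻¹ = (-1 / 2) * ((-2 : ℂ) ^ n)⁻¹ := by
      rw [pow_succ, mul_inv]; norm_num; ring
    rw [hpow]
    set c := ((-2 : ℂ) ^ n)⁻¹
    set D := deriv (besselK μ) (2 * π * y)
    set k := besselK μ (2 * π * y)
    have hcancel : ((2 * π : ℝ) : ℂ)
        * (((((2 * π * y : ℝ) : ℂ)) ^ 2 + μ ^ 2) * k / ((2 * π * y : ℝ) : ℂ))
        = ((((2 * π * y : ℝ) : ℂ)) ^ 2 + μ ^ 2) * k / y := by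
      push_cast
      field_simp
    rw [hcancel] at hEq
    have hyy : (y : ℂ)⁻¹ * y = 1 := inv_mul_cancel₀ hyc
    push_cast at hEq ihy ⊢
    linear_combination (-1 / 2) * hEq + (-1 / 2) * (3 * α / 2 + 2 * n + 2) * ihy
      - (1 / 2) * c * (polyPQ μ α n).2.eval (y : ℂ) * ((2 * π * y) ^ 2 + μ ^ 2) * k * hyy

/-- With `μ = (β−γ)/2`, the Barnes integrals `Iₙ` are expressed in terms of the K-Bessel
function and its derivative via the polynomials `Pₙ, Qₙ`:
`Iₙ(y) = (−2)^{−n}·(Pₙ(y)·K_μ(2πy) + 2πy·Qₙ(y)·K_μ′(2πy))`. -/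
theorem barnesI_eq_polyPQ (α β γ : ℂ) (hsum : α + β + γ = 0)
    (hα : α.re = 0) (hβ : β.re = 0) (hγ : γ.re = 0) (σ : ℝ) (hσ : 0 < σ) :
    ∀ n : ℕ, ∀ y : ℝ, 0 < y →
      barnesI α β γ σ n y
        = ((-2 : ℂ) ^ n)⁻¹
          * ((polyPQ ((β - γ) / 2) α n).1.eval (y : ℂ) * besselK ((β - γ) / 2) (2 * π * y)
            + 2 * π * y * (polyPQ ((β - γ) / 2) α n).2.eval (y : ℂ)
              * deriv (besselK ((β - γ) / 2)) (2 * π * y)) := by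
  intro n y hy
  have hμ : ((β - γ) / 2).re = 0 := by simp [hβ, hγ]
  rw [barnesI_eq_barnesB hsum hα hσ, barnesB_shiftPoly_eq hμ α hσ n y hy]
  push_cast
  ring
end

section
/- Let α, β, γ ∈ ℂ with α + β + γ = 0 and Re α = Re β = Re γ = 0, let σ₁, σ₂ > 0 be real, let y₁, y₂ > 0, and set D = y₁²·y₂. Then Jacquet's Whittaker function satisfies W(y₁,y₂) = ((π³D)^{(1−σ₁)/2}·(πy₂)^{(1−2σ₂+σ₁)/2}/(2π²)) · ∫_{−∞}^{∞} ∫_{−∞}^{∞} [Γ((σ₁+α)/2 + it₁)·Γ((σ₁+β)/2 + it₁)·Γ((σ₁+γ)/2 + it₁) / Γ((σ₁+σ₂+i(t₂+3t₁))/2)] · Γ((σ₂+i(t₂+t₁)−α)/2)·Γ((σ₂+i(t₂+t₁)−β)/2)·Γ((σ₂+i(t₂+t₁)−γ)/2) · (π³D)^{−it₁}·(πy₂)^{−it₂} dt₁ dt₂, the double integral converging absolutely; in particular W(y₁,y₂) is expressed as a function of D = y₁²y₂ and y₂. -/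
open MeasureTheory Real Set

/-- Jacquet's Whittaker function for `SL(3,ℤ)`, defined for `y₁, y₂ > 0` by Stade's formula
`W(y₁,y₂) = 16·(πy₁)^{1−γ/2}·(πy₂)^{1+γ/2} ∫₀^∞ K_{(α−β)/2}(2πy₁√(1+u))·
K_{(α−β)/2}(2πy₂√(1+1/u))·u^{−3γ/4−1} du`. -/
noncomputable def jacquetW (α β γ : ℂ) (y₁ y₂ : ℝ) : ℂ :=
  16 * ((π * y₁ : ℝ) : ℂ) ^ (1 - γ / 2) * ((π * y₂ : ℝ) : ℂ) ^ (1 + γ / 2) *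
    ∫ u in Ioi (0 : ℝ),
      besselK ((α - β) / 2) (2 * π * y₁ * Real.sqrt (1 + u))
        * besselK ((α - β) / 2) (2 * π * y₂ * Real.sqrt (1 + u⁻¹))
        * (u : ℂ) ^ (-(3 * γ) / 4 - 1)

theorem ofReal_cpow_eq_exp_log_mul {r : ℝ} (hr : 0 < r) (c : ℂ) :
    (r : ℂ) ^ c = Complex.exp (log r * c) := by
  rw [Complex.cpow_def_of_ne_zero (by exact_mod_cast hr.ne'), Complex.ofReal_log hr.le]

/-- The Beta integral over the half line. -/
theorem integrableOn_and_integral_cpow_mul_one_add_cpow {a b : ℂ} (ha : 0 < a.re) (hb : 0 < b.re) :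
    IntegrableOn (fun u : ℝ => (u : ℂ) ^ (a - 1) * ((1 + u : ℝ) : ℂ) ^ (-(a + b))) (Ioi 0) ∧
    ∫ u in Ioi (0 : ℝ), (u : ℂ) ^ (a - 1) * ((1 + u : ℝ) : ℂ) ^ (-(a + b))
      = Complex.Gamma a * Complex.Gamma b / Complex.Gamma (a + b) := by
  have himage : (fun x : ℝ => x / (1 - x)) '' Ioo 0 1 = Ioi 0 := by
    ext w
    simp only [mem_image, mem_Ioo, mem_Ioi]
    constructor
    · rintro ⟨x, ⟨h0, h1⟩, rfl⟩
      exact div_pos h0 (by linarith)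
    · intro hw
      refine ⟨w / (1 + w), ⟨by positivity, by rw [div_lt_one (by positivity)]; linarith⟩, ?_⟩
      have : 1 + w ≠ 0 := by positivity
      field_simp
      ring_nf
  have hderiv : ∀ x ∈ Ioo (0 : ℝ) 1,
      HasDerivWithinAt (fun x : ℝ => x / (1 - x)) (((1 - x) ^ 2)⁻¹) (Ioo 0 1) x := by
    intro x hx
    have h1 : 1 - x ≠ 0 := by linarith [hx.2]
    have := ((hasDerivAt_id x).div ((hasDerivAt_id x).const_sub 1) h1).hasDerivWithinAt
      (s := Ioo 0 1)
    refine this.congr_deriv ?_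
    simp only [id]
    field_simp
    ring
  have hinj : InjOn (fun x : ℝ => x / (1 - x)) (Ioo 0 1) := by
    intro x hx y hy h
    have h1 : 1 - x ≠ 0 := by linarith [hx.2]
    have h2 : 1 - y ≠ 0 := by linarith [hy.2]
    simp only at h
    rw [div_eq_div_iff h1 h2] at h
    linarith
  have hcongr : EqOn (fun x : ℝ => |((1 - x) ^ 2)⁻¹| • (fun u : ℝ =>
        (u : ℂ) ^ (a - 1) * ((1 + u : ℝ) : ℂ) ^ (-(a + b))) (x / (1 - x)))
      (fun x : ℝ => (x : ℂ) ^ (a - 1) * (1 - (x : ℂ)) ^ (b - 1)) (Ioo 0 1) := by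
    intro x hx
    have h1 : 0 < 1 - x := by linarith [hx.2]
    have h1c : ((1 - x : ℝ) : ℂ) ≠ 0 := by exact_mod_cast h1.ne'
    have e1 : 1 + x / (1 - x) = (1 - x)⁻¹ := by field_simp; ring
    have e2 : (((1 - x) ^ 2)⁻¹ : ℝ) = ((1 - x : ℝ) : ℂ) ^ (-2 : ℂ) := by
      rw [Complex.cpow_neg]; norm_cast
    have e3 : (((1 - x)⁻¹ : ℝ) : ℂ) ^ (-(a + b)) = ((1 - x : ℝ) : ℂ) ^ (a + b) := by
      rw [Complex.ofReal_inv, Complex.inv_cpow, Complex.cpow_neg, inv_inv]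
      rw [Complex.arg_ofReal_of_nonneg h1.le]; exact pi_pos.ne
    have e4 : ((x / (1 - x) : ℝ) : ℂ) ^ (a - 1)
        = (x : ℂ) ^ (a - 1) * ((1 - x : ℝ) : ℂ) ^ (1 - a) := by
      rw [div_eq_mul_inv, Complex.ofReal_mul, Complex.mul_cpow_ofReal_nonneg hx.1.le
        (inv_pos.2 h1).le, Complex.ofReal_inv, Complex.inv_cpow, ← Complex.cpow_neg, neg_sub]
      rw [Complex.arg_ofReal_of_nonneg h1.le]; exact pi_pos.ne
    simp only
    rw [abs_of_pos (by positivity), Complex.real_smul, e1, e2, e3, e4]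
    have e5 : (1 - (x : ℂ)) ^ (b - 1) = ((1 - x : ℝ) : ℂ) ^ (-2 : ℂ) *
        (((1 - x : ℝ) : ℂ) ^ (1 - a) * ((1 - x : ℝ) : ℂ) ^ (a + b)) := by
      rw [← Complex.cpow_add _ _ h1c, ← Complex.cpow_add _ _ h1c]
      push_cast
      congr 1
      ring
    rw [e5]
    ring
  have hint := Complex.betaIntegral_convergent ha hb
  rw [intervalIntegrable_iff_integrableOn_Ioo_of_le zero_le_one] at hint
  constructor
  · rw [← himage, integrableOn_image_iff_integrableOn_abs_deriv_smul measurableSet_Ioo hderiv hinj]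
    exact hint.congr_fun hcongr.symm measurableSet_Ioo
  · rw [← himage, integral_image_eq_integral_abs_deriv_smul measurableSet_Ioo hderiv hinj,
      setIntegral_congr_fun measurableSet_Ioo hcongr, ← Complex.betaIntegral_eq_Gamma_mul_div a b ha hb,
      Complex.betaIntegral, intervalIntegral.integral_of_le zero_le_one, integral_Ioc_eq_integral_Ioo]

theorem integrable_and_integral_cosh_cpow_mul_exp {a b : ℂ} (ha : 0 < a.re) (hb : 0 < b.re) :
    Integrable (fun t : ℝ => (cosh t : ℂ) ^ (-(a + b)) * Complex.exp ((a - b) * t)) ∧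
    ∫ t : ℝ, (cosh t : ℂ) ^ (-(a + b)) * Complex.exp ((a - b) * t)
      = 2 ^ (a + b - 1) * (Complex.Gamma a * Complex.Gamma b / Complex.Gamma (a + b)) := by
  obtain ⟨hint, hval⟩ := integrableOn_and_integral_cpow_mul_one_add_cpow ha hb
  have himage : (fun t : ℝ => exp (2 * t)) '' univ = Ioi 0 := by
    ext w
    simp only [image_univ, mem_range, mem_Ioi]
    constructor
    · rintro ⟨x, rfl⟩
      positivity
    · intro hw
      exact ⟨log w / 2, by rw [mul_div_cancel₀ _ two_ne_zero, exp_log hw]⟩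
  have hderiv : ∀ t ∈ (univ : Set ℝ),
      HasDerivWithinAt (fun t : ℝ => exp (2 * t)) (exp (2 * t) * 2) univ t := by
    intro t _
    simpa using (((hasDerivAt_id t).const_mul 2).exp).hasDerivWithinAt (s := univ)
  have hinj : InjOn (fun t : ℝ => exp (2 * t)) univ := by
    intro x _ y _ h
    simpa using h
  have h2 : (2 : ℂ) ≠ 0 := two_ne_zero
  have hcongr : (fun t : ℝ => |exp (2 * t) * 2| • (fun u : ℝ =>
        (u : ℂ) ^ (a - 1) * ((1 + u : ℝ) : ℂ) ^ (-(a + b))) (exp (2 * t)))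
      = fun t : ℝ => 2 ^ (1 - (a + b)) *
        ((cosh t : ℂ) ^ (-(a + b)) * Complex.exp ((a - b) * t)) := by
    ext t
    have e0 : 1 + exp (2 * t) = 2 * (exp t * cosh t) := by
      rw [cosh_eq, two_mul, exp_add, exp_neg]
      have := exp_pos t
      field_simp
      ring
    have e1 (r : ℝ) (c : ℂ) : ((exp r : ℝ) : ℂ) ^ c = Complex.exp (r * c) := by
      rw [ofReal_cpow_eq_exp_log_mul (exp_pos r), log_exp]
    simp only
    rw [abs_of_pos (by positivity), Complex.real_smul, e0, Complex.ofReal_mul 2,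
      Complex.mul_cpow_ofReal_nonneg (by norm_num) (by positivity [cosh_pos t]),
      Complex.ofReal_mul (exp t), Complex.mul_cpow_ofReal_nonneg (exp_pos t).le (cosh_pos t).le,
      e1, e1, Complex.ofReal_mul, Complex.ofReal_exp, sub_eq_add_neg 1 (a + b),
      Complex.cpow_add _ _ h2, Complex.cpow_one]
    have e2 : Complex.exp ((a - b) * t) = Complex.exp ((2 * t : ℝ)) *
        (Complex.exp ((2 * t : ℝ) * (a - 1)) * Complex.exp (t * (-(a + b)))) := by
      rw [← Complex.exp_add, ← Complex.exp_add]
      congr 1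
      push_cast
      ring
    rw [e2]
    push_cast
    ring
  rw [← himage, integrableOn_image_iff_integrableOn_abs_deriv_smul MeasurableSet.univ hderiv hinj,
    hcongr, integrableOn_univ] at hint
  rw [← himage, integral_image_eq_integral_abs_deriv_smul MeasurableSet.univ hderiv hinj,
    hcongr, setIntegral_univ, integral_const_mul] at hval
  have h2' : (2 : ℂ) ^ (a + b - 1) * 2 ^ (1 - (a + b)) = 1 := by
    rw [← Complex.cpow_add _ _ h2]; simp
  constructor
  · have := hint.const_mul (2 ^ (a + b - 1))
    simpa only [← mul_assoc, h2', one_mul] using this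
  · rw [← hval, ← mul_assoc, h2', one_mul]

theorem integrableOn_and_integral_cosh_cpow_mul_cosh {s ν : ℂ} (hs : |ν.re| < s.re) :
    IntegrableOn (fun t : ℝ => (cosh t : ℂ) ^ (-s) * Complex.cosh (ν * t)) (Ioi 0) ∧
    ∫ t in Ioi (0 : ℝ), (cosh t : ℂ) ^ (-s) * Complex.cosh (ν * t)
      = 2 ^ (s - 2) * (Complex.Gamma ((s + ν) / 2) * Complex.Gamma ((s - ν) / 2)
        / Complex.Gamma s) := by
  rw [abs_lt] at hs
  have ha : 0 < ((s + ν) / 2).re := by simp; linarith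
  have hb : 0 < ((s - ν) / 2).re := by simp; linarith
  obtain ⟨i1, v1⟩ := integrable_and_integral_cosh_cpow_mul_exp ha hb
  obtain ⟨i2, v2⟩ := integrable_and_integral_cosh_cpow_mul_exp hb ha
  have e1 : (s + ν) / 2 + (s - ν) / 2 = s := by ring
  have e2 : (s - ν) / 2 + (s + ν) / 2 = s := by ring
  have e3 : (s + ν) / 2 - (s - ν) / 2 = ν := by ring
  have e4 : (s - ν) / 2 - (s + ν) / 2 = -ν := by ring
  rw [e1, e3] at i1 v1
  rw [e2, e4] at i2 v2
  have hE : (fun t : ℝ => (cosh t : ℂ) ^ (-s) * Complex.cosh (ν * t)) = fun t : ℝ =>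
      ((cosh t : ℂ) ^ (-s) * Complex.exp (ν * t) + (cosh t : ℂ) ^ (-s) * Complex.exp (-ν * t)) / 2 := by
    ext t
    rw [Complex.cosh, neg_mul]
    ring
  have hI : Integrable (fun t : ℝ => (cosh t : ℂ) ^ (-s) * Complex.cosh (ν * t)) := by
    rw [hE]
    exact (i1.add i2).div_const 2
  refine ⟨hI.integrableOn, ?_⟩
  have hneg := integral_comp_neg_Ioi 0
    (fun t : ℝ => (cosh t : ℂ) ^ (-s) * Complex.cosh (ν * t))
  simp only [cosh_neg, Complex.ofReal_neg, mul_neg, Complex.cosh_neg, neg_zero] at hneg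
  have htwo := intervalIntegral.integral_Iic_add_Ioi (b := 0) hI.integrableOn hI.integrableOn
  rw [← hneg, ← two_mul] at htwo
  have hpow : (2 : ℂ) ^ (s - 1) = 2 * 2 ^ (s - 2) := by
    rw [show s - 1 = 1 + (s - 2) by ring, Complex.cpow_add _ _ two_ne_zero, Complex.cpow_one]
  have hfull : ∫ t : ℝ, (cosh t : ℂ) ^ (-s) * Complex.cosh (ν * t)
      = 2 * (2 ^ (s - 2) * (Complex.Gamma ((s + ν) / 2) * Complex.Gamma ((s - ν) / 2)
        / Complex.Gamma s)) := by
    rw [hE, integral_div, integral_add i1 i2, v1, v2, hpow]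
    ring
  exact mul_left_cancel₀ two_ne_zero (htwo.trans hfull)

theorem mellinConvergent_and_mellin_besselK {s ν : ℂ} (hs : |ν.re| < s.re) :
    MellinConvergent (besselK ν) s ∧
    mellin (besselK ν) s = 2 ^ (s - 2) * Complex.Gamma ((s + ν) / 2)
      * Complex.Gamma ((s - ν) / 2) := by
  have hs0 : 0 < s.re := (abs_nonneg _).trans_lt hs
  obtain ⟨hint, hval⟩ := integrableOn_and_integral_cosh_cpow_mul_cosh hs
  let F : ℝ × ℝ → ℂ := fun p => (p.2 : ℂ) ^ (s - 1) *
    (Complex.exp (-(p.2 : ℂ) * cosh p.1) * Complex.cosh (ν * p.1))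
  have hmeas : AEStronglyMeasurable F
      ((volume.restrict (Ioi 0)).prod (volume.restrict (Ioi 0))) := by
    apply Measurable.aestronglyMeasurable
    have : Measurable cosh := continuous_cosh.measurable
    have : Measurable Complex.cosh := Complex.continuous_cosh.measurable
    fun_prop
  have hinner (t : ℝ) : ∫ x in Ioi (0 : ℝ), F (t, x)
      = Complex.Gamma s * ((cosh t : ℂ) ^ (-s) * Complex.cosh (ν * t)) := by
    have := Complex.integral_cpow_mul_exp_neg_mul_Ioi hs0 (cosh_pos t)
    simp only [F, ← mul_assoc]
    rw [integral_mul_const]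
    have e : ((1 : ℂ) / (cosh t : ℝ)) ^ s = (cosh t : ℂ) ^ (-s) := by
      rw [one_div, Complex.inv_cpow, Complex.cpow_neg]
      rw [Complex.arg_ofReal_of_nonneg (cosh_pos t).le]; exact pi_pos.ne
    rw [e] at this
    rw [mul_comm (Complex.Gamma s), ← this]
    congr 2
    ext x
    ring_nf
  have hnorm (t : ℝ) : EqOn (fun x => ‖F (t, x)‖)
      (fun x => x ^ (s.re - 1) * exp (-(cosh t * x)) * ‖Complex.cosh (ν * t)‖) (Ioi 0) := by
    intro x hx
    simp only [F, norm_mul, Complex.norm_exp, Complex.norm_cpow_eq_rpow_re_of_pos hx]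
    rw [mul_assoc]
    congr 3
    · norm_cast
      simp [mul_comm]
  have hgam (t : ℝ) : IntegrableOn (fun x => x ^ (s.re - 1) * exp (-(cosh t * x))) (Ioi 0) := by
    simpa using integrableOn_rpow_mul_exp_neg_mul_rpow (p := 1) (s := s.re - 1) (b := cosh t)
      (by linarith) one_pos (cosh_pos t)
  have hF : Integrable F ((volume.restrict (Ioi 0)).prod (volume.restrict (Ioi 0))) := by
    rw [integrable_prod_iff hmeas]
    constructor
    · refine .of_forall fun t => ?_
      have hm : AEStronglyMeasurable (fun x => F (t, x)) (volume.restrict (Ioi 0)) := by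
        apply Measurable.aestronglyMeasurable
        fun_prop
      rw [← integrable_norm_iff hm]
      exact IntegrableOn.congr_fun ((hgam t).mul_const _) (hnorm t).symm measurableSet_Ioi
    · refine (hint.norm.const_mul (Real.Gamma s.re)).congr (.of_forall fun t => ?_)
      simp only
      rw [setIntegral_congr_fun measurableSet_Ioi (hnorm t), integral_mul_const,
        integral_rpow_mul_exp_neg_mul_Ioi hs0 (cosh_pos t), norm_mul,
        Complex.norm_cpow_eq_rpow_re_of_pos (cosh_pos t), one_div, inv_rpow (cosh_pos t).le,
        Complex.neg_re, rpow_neg (cosh_pos t).le]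
      ring
  have hK (x : ℝ) : ∫ t in Ioi (0 : ℝ), F (t, x) = (x : ℂ) ^ (s - 1) • besselK ν x := by
    simp only [F]
    rw [integral_const_mul, smul_eq_mul, besselK]
  constructor
  · exact (hF.integral_prod_right).congr (.of_forall hK)
  · rw [mellin, ← integral_congr_ae (.of_forall hK), integral_integral_swap
      (f := fun x t => F (t, x)) hF.swap]
    simp_rw [hinner]
    rw [integral_const_mul, hval]
    have := Complex.Gamma_ne_zero_of_re_pos hs0
    field_simp

theorem continuousAt_besselK_s17 {ν : ℂ} (hν : ν.re = 0) {x : ℝ} (hx : 0 < x) :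
    ContinuousAt (besselK ν) x := by
  have hc : Continuous Complex.cosh := Complex.continuous_cosh
  refine continuousAt_of_dominated (bound := fun t => exp (-(x / 4) * t)) (.of_forall fun y => ?_)
    ?_ (exp_neg_integrableOn_Ioi 0 (by positivity)) (.of_forall fun t => ?_)
  · have : Continuous cosh := continuous_cosh
    exact Continuous.aestronglyMeasurable (by fun_prop)
  · filter_upwards [lt_mem_nhds (half_lt_self hx)] with y hy
    refine (ae_restrict_iff' measurableSet_Ioi).2 (.of_forall fun t ht => ?_)
    have ht : 0 < t := ht
    have h1 : ‖Complex.cosh (ν * t)‖ ≤ 1 := by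
      rw [Complex.cosh, norm_div]
      have h := norm_add_le (Complex.exp (ν * t)) (Complex.exp (-(ν * t)))
      simp only [Complex.norm_exp, Complex.neg_re, Complex.mul_re, hν, Complex.ofReal_im] at h
      norm_num at h ⊢
      linarith
    have h2 : t / 2 ≤ cosh t := by
      rw [cosh_eq]
      linarith [add_one_le_exp t, exp_pos (-t)]
    have h3 : ‖Complex.exp (-(y : ℂ) * cosh t)‖ ≤ exp (-(x / 4) * t) := by
      rw [Complex.norm_exp, exp_le_exp]
      norm_cast
      nlinarith
    rw [norm_mul]
    calc _ ≤ exp (-(x / 4) * t) * 1 := by gcongr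
      _ = _ := mul_one _
  · fun_prop

theorem norm_Gamma_le_Gamma_re_s17 {z : ℂ} (hz : 0 < z.re) : ‖Complex.Gamma z‖ ≤ Real.Gamma z.re := by
  rw [Complex.Gamma_eq_integral hz, Complex.GammaIntegral, Real.Gamma_eq_integral hz]
  refine (norm_integral_le_integral_norm _).trans_eq
    (setIntegral_congr_fun measurableSet_Ioi fun x hx => ?_)
  simp only [norm_mul, Complex.norm_cpow_eq_rpow_re_of_pos hx, Complex.norm_real, norm_eq_abs,
    abs_exp, Complex.sub_re, Complex.one_re]

theorem continuous_Gamma_vertical {c : ℂ} (hc : 0 < c.re) :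
    Continuous fun t : ℝ => Complex.Gamma (c + Complex.I * t) := by
  refine continuous_iff_continuousAt.2 fun t => ContinuousAt.comp
    (g := Complex.Gamma) (Complex.differentiableAt_Gamma _ fun m h => ?_).continuousAt
    (by fun_prop)
  have := congrArg Complex.re h
  simp at this
  linarith [Nat.cast_nonneg (α := ℝ) m]

theorem integrable_Gamma_vertical {c : ℂ} (hc : 0 < c.re) :
    Integrable fun t : ℝ => Complex.Gamma (c + Complex.I * t) := by
  suffices h : Integrable fun t : ℝ => Complex.Gamma ((c.re : ℂ) + Complex.I * t) by
    refine (h.comp_add_left c.im).congr (.of_forall fun t => ?_)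
    simp only
    congr 1
    conv_rhs => rw [← Complex.re_add_im c]
    push_cast
    ring
  set r := c.re
  refine ((integrable_inv_one_add_sq.const_mul (Real.Gamma (r + 2) * (1 + 1 / r ^ 2)))).mono'
    (continuous_Gamma_vertical (c := (r : ℂ)) (by simpa)).aestronglyMeasurable
    (.of_forall fun t => ?_)
  set z : ℂ := (r : ℂ) + Complex.I * t with hz
  have hre : z.re = r := by simp [hz]
  have him : z.im = t := by simp [hz]
  have hz0 : z ≠ 0 := fun h => by rw [h] at hre; simp at hre; linarith
  have hz1 : z + 1 ≠ 0 := fun h => by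
    have := congrArg Complex.re h
    simp [hre] at this
    linarith
  have hrec : Complex.Gamma (z + 2) = (z + 1) * (z * Complex.Gamma z) := by
    rw [← Complex.Gamma_add_one z hz0, ← Complex.Gamma_add_one (z + 1) hz1]
    ring_nf
  have hle := norm_Gamma_le_Gamma_re_s17 (z := z + 2) (by simp [hre]; linarith)
  rw [hrec, norm_mul, norm_mul] at hle
  simp only [Complex.add_re, hre, Complex.re_ofNat] at hle
  have hsq : ‖z‖ ^ 2 = r ^ 2 + t ^ 2 := by
    rw [Complex.sq_norm, Complex.normSq_apply, hre, him]; ring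
  have hmono : ‖z‖ ≤ ‖z + 1‖ := by
    refine le_of_sq_le_sq ?_ (norm_nonneg _)
    rw [hsq, Complex.sq_norm, Complex.normSq_apply]
    simp [hre, him]
    nlinarith
  have hle2 : (r ^ 2 + t ^ 2) * ‖Complex.Gamma z‖ ≤ Real.Gamma (r + 2) := by
    rw [← hsq]
    refine le_trans ?_ hle
    rw [pow_two, mul_assoc]
    gcongr
  have hq : 1 + t ^ 2 ≤ (1 + 1 / r ^ 2) * (r ^ 2 + t ^ 2) := by
    have : (1 + 1 / r ^ 2) * (r ^ 2 + t ^ 2) = 1 + t ^ 2 + (r ^ 2 + t ^ 2 / r ^ 2) := by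
      field_simp
      ring
    rw [this]
    have : 0 ≤ r ^ 2 + t ^ 2 / r ^ 2 := by positivity
    linarith
  rw [← div_eq_mul_inv, le_div_iff₀ (by positivity)]
  calc ‖Complex.Gamma z‖ * (1 + t ^ 2)
      ≤ ‖Complex.Gamma z‖ * ((1 + 1 / r ^ 2) * (r ^ 2 + t ^ 2)) := by gcongr
    _ = ((r ^ 2 + t ^ 2) * ‖Complex.Gamma z‖) * (1 + 1 / r ^ 2) := by ring
    _ ≤ _ := by gcongr

theorem continuous_Gamma_mul_Gamma_vertical {a b : ℂ} (ha : 0 < a.re) (hb : 0 < b.re) :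
    Continuous fun t : ℝ =>
      Complex.Gamma (a + Complex.I * t) * Complex.Gamma (b + Complex.I * t) :=
  (continuous_Gamma_vertical ha).mul (continuous_Gamma_vertical hb)

theorem integrable_Gamma_mul_Gamma_vertical {a b : ℂ} (ha : 0 < a.re) (hb : 0 < b.re) :
    Integrable fun t : ℝ =>
      Complex.Gamma (a + Complex.I * t) * Complex.Gamma (b + Complex.I * t) := by
  refine (integrable_Gamma_vertical ha).mul_bdd (c := Real.Gamma b.re)
    (continuous_Gamma_vertical hb).aestronglyMeasurable (.of_forall fun t => ?_)
  simpa using norm_Gamma_le_Gamma_re_s17 (z := b + Complex.I * t) (by simpa using hb)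

/-- Mellin-Barnes representation of the Bessel function. -/
theorem cpow_mul_besselK_eq_integral {κ ν : ℂ} (hκ : κ.re = 0) (hν : ν.re = 0) {σ : ℝ} (hσ : 0 < σ)
    {x : ℝ} (hx : 0 < x) :
    (x : ℂ) ^ κ * besselK ν (2 * x) = 1 / (4 * π) * ∫ t : ℝ, (x : ℂ) ^ (-(σ + 2 * Complex.I * t)) *
      (Complex.Gamma ((σ + κ + ν) / 2 + Complex.I * t)
        * Complex.Gamma ((σ + κ - ν) / 2 + Complex.I * t)) := by
  let H : ℝ → ℂ := fun x => (x : ℂ) ^ κ • besselK ν (2 * x)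
  have hs (y : ℝ) : |ν.re| < (σ + y * Complex.I + κ).re := by simpa [hν, hκ]
  have hconv : MellinConvergent H σ := by
    refine MellinConvergent.cpow_smul.2 ((MellinConvergent.comp_mul_left two_pos).2 ?_)
    simpa using (mellinConvergent_and_mellin_besselK (hs 0)).1
  have hmel (y : ℝ) : mellin H (σ + y * Complex.I) = 1 / 4 *
      (Complex.Gamma ((σ + κ + ν) / 2 + Complex.I * (2⁻¹ * y : ℝ))
        * Complex.Gamma ((σ + κ - ν) / 2 + Complex.I * (2⁻¹ * y : ℝ))) := by
    simp only [H]
    rw [mellin_cpow_smul, mellin_comp_mul_left _ _ two_pos,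
      (mellinConvergent_and_mellin_besselK (hs y)).2, smul_eq_mul, mul_assoc, ← mul_assoc,
      Complex.ofReal_ofNat, ← Complex.cpow_add _ _ two_ne_zero]
    congr 1
    · rw [show -(σ + y * Complex.I + κ) + (σ + y * Complex.I + κ - 2) = -2 by ring,
        Complex.cpow_neg]
      norm_num
    · push_cast
      ring_nf
  have ha : 0 < ((σ + κ + ν) / 2).re := by simp [hκ, hν, hσ]
  have hb : 0 < ((σ + κ - ν) / 2).re := by simp [hκ, hν, hσ]
  have hvert : Complex.VerticalIntegrable (mellin H) σ := by
    simp only [Complex.VerticalIntegrable, hmel]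
    exact ((integrable_Gamma_mul_Gamma_vertical ha hb).comp_mul_left'
      (inv_ne_zero two_ne_zero)).const_mul _
  have hcont : ContinuousAt H x := by
    refine ContinuousAt.mul (M := ℂ) ?_ ?_
    · exact Complex.continuous_ofReal.continuousAt.cpow continuousAt_const
        (Complex.ofReal_mem_slitPlane.2 hx)
    · exact ContinuousAt.comp (g := besselK ν) (continuousAt_besselK_s17 hν (by positivity))
        (by fun_prop)
  have hinv := mellinInv_mellin_eq σ H hx hconv hvert hcont
  rw [mellinInv] at hinv
  simp only [hmel] at hinv
  simp only [smul_eq_mul, H] at hinv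
  have hscale := Measure.integral_comp_mul_left (fun y : ℝ => (x : ℂ) ^ (-(σ + y * Complex.I)) *
    (1 / 4 * (Complex.Gamma ((σ + κ + ν) / 2 + Complex.I * (2⁻¹ * y : ℝ))
        * Complex.Gamma ((σ + κ - ν) / 2 + Complex.I * (2⁻¹ * y : ℝ))))) 2
  rw [abs_of_pos (by norm_num), Complex.real_smul] at hscale
  rw [← hinv]
  have h2 (A B : ℂ) (h : A = (2⁻¹ : ℝ) * B) : B = 2 * A := by rw [h]; push_cast; ring
  rw [h2 _ _ hscale, Complex.real_smul, ← integral_const_mul, ← integral_const_mul,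
    ← integral_const_mul]
  congr 1
  ext t
  rw [inv_mul_cancel_left₀ two_ne_zero]
  push_cast
  ring_nf

/-- Mellin-Barnes representation of the Bessel function, with the vertical line parametrized by
its imaginary part. -/
theorem cpow_mul_besselK_eq_integral' {κ ν : ℂ} (hκ : κ.re = 0) (hν : ν.re = 0) {σ : ℝ}
    (hσ : 0 < σ) {x : ℝ} (hx : 0 < x) :
    (x : ℂ) ^ κ * besselK ν (2 * x) = 1 / (8 * π) * ∫ t : ℝ, (x : ℂ) ^ (-(σ + Complex.I * t)) *
      (Complex.Gamma ((σ + Complex.I * t + κ + ν) / 2)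
        * Complex.Gamma ((σ + Complex.I * t + κ - ν) / 2)) := by
  have hscale := Measure.integral_comp_mul_left (fun y : ℝ => (x : ℂ) ^ (-(σ + Complex.I * y)) *
    (Complex.Gamma ((σ + Complex.I * y + κ + ν) / 2)
        * Complex.Gamma ((σ + Complex.I * y + κ - ν) / 2))) 2
  rw [abs_of_pos (by norm_num), Complex.real_smul] at hscale
  have h2 (A B : ℂ) (h : A = (2⁻¹ : ℝ) * B) : B = 2 * A := by rw [h]; push_cast; ring
  rw [cpow_mul_besselK_eq_integral hκ hν hσ hx, h2 _ _ hscale, ← mul_assoc]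
  congr 1
  · field_simp
    norm_num
  · congr 1
    ext t
    push_cast
    ring_nf

/-- Absolute integrability of two vertically integrable functions against the Beta-integral
kernel. -/
theorem integrable_Gamma_mul_beta_kernel {P Q : ℝ → ℂ} (hP : Integrable P) (hQ : Integrable Q)
    (hPc : Continuous P) (hQc : Continuous Q) {γ : ℂ} (hγ : γ.re = 0) {σ₁ σ₂ : ℝ} (hσ₁ : 0 < σ₁)
    (hσ₂ : 0 < σ₂) {X Y : ℝ} (hX : 0 < X) (hY : 0 < Y) :
    Integrable (fun p : (ℝ × ℝ) × ℝ =>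
      P p.1.1 * Q p.1.2 * (X : ℂ) ^ (-(2 * Complex.I * p.1.1)) * (Y : ℂ) ^ (-(Complex.I * p.1.2)) *
      ((p.2 : ℂ) ^ ((σ₂ + Complex.I * p.1.2 - γ) / 2 - 1) * ((1 + p.2 : ℝ) : ℂ) ^
        (-((σ₂ + Complex.I * p.1.2 - γ) / 2 + ((σ₁ + γ) / 2 + Complex.I * p.1.1)))))
      (volume.prod (volume.restrict (Ioi 0))) := by
  have hbase := (hP.mul_prod hQ).mul_prod (integrableOn_and_integral_cpow_mul_one_add_cpow
    (a := (σ₂ / 2 : ℝ)) (b := (σ₁ / 2 : ℝ)) (by simpa) (by simpa)).1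
  have hPm := hPc.measurable
  have hQm := hQc.measurable
  refine hbase.mono (Measurable.aestronglyMeasurable (by fun_prop)) ?_
  have hpos : ∀ᵐ p : (ℝ × ℝ) × ℝ ∂(volume.prod (volume.restrict (Ioi 0))), p.2 ∈ Ioi (0 : ℝ) :=
    Measure.quasiMeasurePreserving_snd.ae (ae_restrict_mem measurableSet_Ioi)
  filter_upwards [hpos] with p hp
  have hp0 : 0 < p.2 := hp
  have hp1 : 0 < 1 + p.2 := by linarith
  simp only [norm_mul, Complex.norm_cpow_eq_rpow_re_of_pos hp0,
    Complex.norm_cpow_eq_rpow_re_of_pos hp1, Complex.norm_cpow_eq_rpow_re_of_pos hX,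
    Complex.norm_cpow_eq_rpow_re_of_pos hY]
  simp [hγ]

theorem jacquetW_integrand_eq {α β γ : ℂ} (hsum : α + β + γ = 0)
    (hα : α.re = 0) (hβ : β.re = 0) (hγ : γ.re = 0) {σ₁ σ₂ : ℝ} (hσ₁ : 0 < σ₁) (hσ₂ : 0 < σ₂)
    {y₁ y₂ u : ℝ} (hy₁ : 0 < y₁) (hy₂ : 0 < y₂) (hu : 0 < u) :
    16 * ((π * y₁ : ℝ) : ℂ) ^ (1 - γ / 2) * ((π * y₂ : ℝ) : ℂ) ^ (1 + γ / 2) *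
      (besselK ((α - β) / 2) (2 * π * y₁ * Real.sqrt (1 + u))
        * besselK ((α - β) / 2) (2 * π * y₂ * Real.sqrt (1 + u⁻¹))
        * (u : ℂ) ^ (-(3 * γ) / 4 - 1))
    = ((π * y₁ : ℝ) : ℂ) ^ (1 - σ₁ : ℂ) * ((π * y₂ : ℝ) : ℂ) ^ (1 - σ₂ : ℂ) / (2 * π ^ 2) *
      ∫ t : ℝ × ℝ, (Complex.Gamma ((σ₁ + α) / 2 + Complex.I * t.1)
          * Complex.Gamma ((σ₁ + β) / 2 + Complex.I * t.1)) *
        (Complex.Gamma ((σ₂ + Complex.I * t.2 - α) / 2)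
          * Complex.Gamma ((σ₂ + Complex.I * t.2 - β) / 2)) *
        ((π * y₁ : ℝ) : ℂ) ^ (-(2 * Complex.I * t.1)) * ((π * y₂ : ℝ) : ℂ) ^ (-(Complex.I * t.2)) *
        ((u : ℂ) ^ ((σ₂ + Complex.I * t.2 - γ) / 2 - 1) * ((1 + u : ℝ) : ℂ) ^
          (-((σ₂ + Complex.I * t.2 - γ) / 2 + ((σ₁ + γ) / 2 + Complex.I * t.1)))) := by
  have hX : 0 < π * y₁ := by positivity
  have hY : 0 < π * y₂ := by positivity
  set X := π * y₁
  set Y := π * y₂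
  set x₁ := X * √(1 + u) with hx₁
  set x₂ := Y * √(1 + u⁻¹) with hx₂
  have hx₁0 : 0 < x₁ := by positivity
  have hx₂0 : 0 < x₂ := by positivity
  have hu1 : 0 < 1 + u := by positivity
  have hγ' : (-γ / 2).re = 0 := by simp [hγ]
  have hγ'' : (γ / 2).re = 0 := by simp [hγ]
  have hν : ((α - β) / 2).re = 0 := by simp [hα, hβ]
  have h1 := cpow_mul_besselK_eq_integral hγ' hν hσ₁ hx₁0
  have h2 := cpow_mul_besselK_eq_integral' hγ'' hν hσ₂ hx₂0
  have hl₁ : log x₁ = log X + log (1 + u) / 2 := by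
    rw [hx₁, log_mul (by positivity) (by positivity), log_sqrt (by positivity)]
  have hl₂ : log x₂ = log Y + (log (1 + u) - log u) / 2 := by
    rw [hx₂, log_mul (by positivity) (by positivity), log_sqrt (by positivity),
      ← log_div (by positivity) (by positivity)]
    congr 3
    field_simp
    ring
  have e1 : 2 * π * y₁ * √(1 + u) = 2 * x₁ := by simp only [hx₁, X]; ring
  have e2 : 2 * π * y₂ * √(1 + u⁻¹) = 2 * x₂ := by simp only [hx₂, Y]; ring
  have hπ : (π : ℂ) ≠ 0 := by exact_mod_cast pi_pos.ne'
  clear_value x₁ x₂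
  have hK₁ : besselK ((α - β) / 2) (2 * x₁) = (x₁ : ℂ) ^ (γ / 2) *
      ((x₁ : ℂ) ^ (-γ / 2) * besselK ((α - β) / 2) (2 * x₁)) := by
    rw [← mul_assoc, ofReal_cpow_eq_exp_log_mul hx₁0, ofReal_cpow_eq_exp_log_mul hx₁0,
      ← Complex.exp_add]
    ring_nf
    simp
  have hK₂ : besselK ((α - β) / 2) (2 * x₂) = (x₂ : ℂ) ^ (-γ / 2) *
      ((x₂ : ℂ) ^ (γ / 2) * besselK ((α - β) / 2) (2 * x₂)) := by
    rw [← mul_assoc, ofReal_cpow_eq_exp_log_mul hx₂0, ofReal_cpow_eq_exp_log_mul hx₂0,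
      ← Complex.exp_add]
    ring_nf
    simp
  rw [e1, e2, hK₁, hK₂, h1, h2]
  have hcollect (A B C D E F G : ℂ) :
      16 * A * B * (C * (1 / (4 * π) * D) * (E * (1 / (8 * π) * F)) * G)
        = A * B * C * E * G / (2 * π ^ 2) * (D * F) := by
    field_simp
    ring
  rw [hcollect, ← integral_prod_mul, ← Measure.volume_eq_prod, ← integral_const_mul,
    ← integral_const_mul]
  congr 1
  ext t
  have hα' : α = -β - γ := by linear_combination hsum
  have g1 : (σ₁ + -γ / 2 + (α - β) / 2) / 2 = (σ₁ + α) / 2 := by rw [hα']; ring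
  have g2 : (σ₁ + -γ / 2 - (α - β) / 2) / 2 = (σ₁ + β) / 2 := by rw [hα']; ring
  have g3 : (σ₂ + Complex.I * t.2 + γ / 2 + (α - β) / 2) / 2 = (σ₂ + Complex.I * t.2 - β) / 2 := by
    rw [hα']; ring
  have g4 : (σ₂ + Complex.I * t.2 + γ / 2 - (α - β) / 2) / 2 = (σ₂ + Complex.I * t.2 - α) / 2 := by
    rw [hα']; ring
  rw [g1, g2, g3, g4]
  have hexp : (X : ℂ) ^ (1 - γ / 2) * (Y : ℂ) ^ (1 + γ / 2) * (x₁ : ℂ) ^ (γ / 2) *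
      (x₂ : ℂ) ^ (-γ / 2) * (u : ℂ) ^ (-(3 * γ) / 4 - 1) * (x₁ : ℂ) ^ (-(σ₁ + 2 * Complex.I * t.1))
      * (x₂ : ℂ) ^ (-(σ₂ + Complex.I * t.2))
      = (X : ℂ) ^ (1 - σ₁ : ℂ) * (Y : ℂ) ^ (1 - σ₂ : ℂ) * (X : ℂ) ^ (-(2 * Complex.I * t.1))
      * (Y : ℂ) ^ (-(Complex.I * t.2)) * (u : ℂ) ^ ((σ₂ + Complex.I * t.2 - γ) / 2 - 1)
      * ((1 + u : ℝ) : ℂ) ^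
          (-((σ₂ + Complex.I * t.2 - γ) / 2 + ((σ₁ + γ) / 2 + Complex.I * t.1))) := by
    simp only [ofReal_cpow_eq_exp_log_mul hX, ofReal_cpow_eq_exp_log_mul hY,
      ofReal_cpow_eq_exp_log_mul hx₁0, ofReal_cpow_eq_exp_log_mul hx₂0,
      ofReal_cpow_eq_exp_log_mul hu, ofReal_cpow_eq_exp_log_mul hu1,
      ← Complex.exp_add, hl₁, hl₂]
    congr 1
    push_cast
    ring
  linear_combination (1 / (2 * (π : ℂ) ^ 2) * (Complex.Gamma ((σ₁ + α) / 2 + Complex.I * t.1)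
          * Complex.Gamma ((σ₁ + β) / 2 + Complex.I * t.1)) *
        (Complex.Gamma ((σ₂ + Complex.I * t.2 - α) / 2)
          * Complex.Gamma ((σ₂ + Complex.I * t.2 - β) / 2))) * hexp

/-- The double Mellin-Barnes representation of Jacquet's Whittaker function in the variables
`y₁, y₂`. -/
theorem integrable_and_jacquetW_eq_integral {α β γ : ℂ} (hsum : α + β + γ = 0)
    (hα : α.re = 0) (hβ : β.re = 0) (hγ : γ.re = 0) {σ₁ σ₂ : ℝ} (hσ₁ : 0 < σ₁) (hσ₂ : 0 < σ₂)
    {y₁ y₂ : ℝ} (hy₁ : 0 < y₁) (hy₂ : 0 < y₂) {G : ℝ × ℝ → ℂ}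
    (hG : ∀ t, G t = (Complex.Gamma ((σ₁ + α) / 2 + Complex.I * t.1)
          * Complex.Gamma ((σ₁ + β) / 2 + Complex.I * t.1)) *
        (Complex.Gamma ((σ₂ + Complex.I * t.2 - α) / 2)
          * Complex.Gamma ((σ₂ + Complex.I * t.2 - β) / 2)) *
        ((π * y₁ : ℝ) : ℂ) ^ (-(2 * Complex.I * t.1)) * ((π * y₂ : ℝ) : ℂ) ^ (-(Complex.I * t.2)) *
        (Complex.Gamma ((σ₂ + Complex.I * t.2 - γ) / 2)
          * Complex.Gamma ((σ₁ + γ) / 2 + Complex.I * t.1)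
          / Complex.Gamma
            ((σ₂ + Complex.I * t.2 - γ) / 2 + ((σ₁ + γ) / 2 + Complex.I * t.1)))) :
    Integrable G ∧ jacquetW α β γ y₁ y₂ =
      ((π * y₁ : ℝ) : ℂ) ^ (1 - σ₁ : ℂ) * ((π * y₂ : ℝ) : ℂ) ^ (1 - σ₂ : ℂ) / (2 * π ^ 2) *
        ∫ t, G t := by
  have hre₁ {c : ℂ} (hc : c.re = 0) : 0 < ((σ₁ + c) / 2).re := by simp [hc, hσ₁]
  have hre₂ {c : ℂ} (hc : c.re = 0) : 0 < ((σ₂ - c) / 2).re := by simp [hc, hσ₂]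
  have hQ : (fun t : ℝ => Complex.Gamma ((σ₂ + Complex.I * t - α) / 2)
      * Complex.Gamma ((σ₂ + Complex.I * t - β) / 2))
      = fun t : ℝ => (fun t : ℝ => Complex.Gamma ((σ₂ - α) / 2 + Complex.I * t)
      * Complex.Gamma ((σ₂ - β) / 2 + Complex.I * t)) (t * 2⁻¹) := by
    ext t
    push_cast
    ring_nf
  have hQi := (integrable_Gamma_mul_Gamma_vertical (hre₂ hα) (hre₂ hβ)).comp_mul_right'
    (inv_ne_zero two_ne_zero)
  have hQc := (continuous_Gamma_mul_Gamma_vertical (hre₂ hα) (hre₂ hβ)).comp'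
    (continuous_mul_const (2⁻¹ : ℝ))
  rw [← hQ] at hQi hQc
  have hΦ := integrable_Gamma_mul_beta_kernel
    (integrable_Gamma_mul_Gamma_vertical (hre₁ hα) (hre₁ hβ)) hQi
    (continuous_Gamma_mul_Gamma_vertical (hre₁ hα) (hre₁ hβ)) hQc hγ hσ₁ hσ₂
    (mul_pos pi_pos hy₁) (mul_pos pi_pos hy₂)
  have hinner (t : ℝ × ℝ) := (integrableOn_and_integral_cpow_mul_one_add_cpow
    (a := (σ₂ + Complex.I * t.2 - γ) / 2) (b := (σ₁ + γ) / 2 + Complex.I * t.1)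
    (by simp [hγ, hσ₂]) (by simp [hγ, hσ₁])).2
  constructor
  · refine hΦ.integral_prod_left.congr (.of_forall fun t => ?_)
    simp only
    rw [integral_const_mul, hinner, hG]
  · rw [jacquetW, ← integral_const_mul, setIntegral_congr_fun measurableSet_Ioi fun u hu =>
      jacquetW_integrand_eq hsum hα hβ hγ hσ₁ hσ₂ hy₁ hy₂ hu, integral_const_mul,
      (integral_prod_symm _ hΦ).symm.trans (integral_prod _ hΦ)]
    congr 2
    ext t
    simp only
    rw [integral_const_mul, hinner, hG]

/-- Jacquet's Whittaker function as a function of `D = y₁²y₂` and `y₂`: an absolutely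
convergent double inverse Mellin representation in which the first variable enters only
through `D`. -/
theorem jacquetW_of_D (α β γ : ℂ) (hsum : α + β + γ = 0)
    (hα : α.re = 0) (hβ : β.re = 0) (hγ : γ.re = 0)
    (σ₁ σ₂ : ℝ) (hσ₁ : 0 < σ₁) (hσ₂ : 0 < σ₂)
    (y₁ y₂ : ℝ) (hy₁ : 0 < y₁) (hy₂ : 0 < y₂)
    (D : ℝ) (hD : D = y₁ ^ 2 * y₂) :
    Integrable (fun t : ℝ × ℝ =>
      Complex.Gamma ((σ₁ + α) / 2 + Complex.I * t.1)
      * Complex.Gamma ((σ₁ + β) / 2 + Complex.I * t.1)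
      * Complex.Gamma ((σ₁ + γ) / 2 + Complex.I * t.1)
      / Complex.Gamma (((σ₁ : ℂ) + σ₂ + Complex.I * (t.2 + 3 * t.1)) / 2)
      * Complex.Gamma (((σ₂ : ℂ) + Complex.I * (t.2 + t.1) - α) / 2)
      * Complex.Gamma (((σ₂ : ℂ) + Complex.I * (t.2 + t.1) - β) / 2)
      * Complex.Gamma (((σ₂ : ℂ) + Complex.I * (t.2 + t.1) - γ) / 2)
      * ((π ^ 3 * D : ℝ) : ℂ) ^ (-(Complex.I * t.1))
      * ((π * y₂ : ℝ) : ℂ) ^ (-(Complex.I * t.2))) ∧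
    jacquetW α β γ y₁ y₂
      = ((((π ^ 3 * D) ^ ((1 - σ₁) / 2) : ℝ) : ℂ)
          * (((π * y₂) ^ ((1 - 2 * σ₂ + σ₁) / 2) : ℝ) : ℂ) / (2 * π ^ 2))
        * ∫ t : ℝ × ℝ,
            Complex.Gamma ((σ₁ + α) / 2 + Complex.I * t.1)
            * Complex.Gamma ((σ₁ + β) / 2 + Complex.I * t.1)
            * Complex.Gamma ((σ₁ + γ) / 2 + Complex.I * t.1)
            / Complex.Gamma (((σ₁ : ℂ) + σ₂ + Complex.I * (t.2 + 3 * t.1)) / 2)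
            * Complex.Gamma (((σ₂ : ℂ) + Complex.I * (t.2 + t.1) - α) / 2)
            * Complex.Gamma (((σ₂ : ℂ) + Complex.I * (t.2 + t.1) - β) / 2)
            * Complex.Gamma (((σ₂ : ℂ) + Complex.I * (t.2 + t.1) - γ) / 2)
            * ((π ^ 3 * D : ℝ) : ℂ) ^ (-(Complex.I * t.1))
            * ((π * y₂ : ℝ) : ℂ) ^ (-(Complex.I * t.2)) := by
  have hX : 0 < π * y₁ := mul_pos pi_pos hy₁
  have hY : 0 < π * y₂ := mul_pos pi_pos hy₂
  have hDpos : 0 < π ^ 3 * D := by rw [hD]; positivity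
  have hDlog : log (π ^ 3 * D) = 2 * log (π * y₁) + log (π * y₂) := by
    rw [hD, show π ^ 3 * (y₁ ^ 2 * y₂) = (π * y₁) ^ 2 * (π * y₂) by ring,
      log_mul (by positivity) (by positivity), log_pow]
    norm_num
  obtain ⟨hint, hW⟩ := integrable_and_jacquetW_eq_integral hsum hα hβ hγ hσ₁ hσ₂ hy₁ hy₂
    fun _ => rfl
  have hshear := measurePreserving_prod_add (volume : Measure ℝ) (volume : Measure ℝ)
  rw [← Measure.volume_eq_prod] at hshear
  have hemb : MeasurableEmbedding fun z : ℝ × ℝ => (z.1, z.1 + z.2) :=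
    (MeasurableEquiv.shearAddRight ℝ).measurableEmbedding
  rw [← hshear.integral_comp hemb] at hW
  have hpow (t : ℝ × ℝ) :
      ((π * y₁ : ℝ) : ℂ) ^ (-(2 * Complex.I * t.1))
        * ((π * y₂ : ℝ) : ℂ) ^ (-(Complex.I * (t.1 + t.2 : ℝ)))
      = ((π ^ 3 * D : ℝ) : ℂ) ^ (-(Complex.I * t.1))
        * ((π * y₂ : ℝ) : ℂ) ^ (-(Complex.I * t.2)) := by
    rw [ofReal_cpow_eq_exp_log_mul hX, ofReal_cpow_eq_exp_log_mul hY,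
      ofReal_cpow_eq_exp_log_mul hDpos, ofReal_cpow_eq_exp_log_mul hY, hDlog,
      ← Complex.exp_add, ← Complex.exp_add]
    congr 1
    push_cast
    ring
  have hconst : ((π * y₁ : ℝ) : ℂ) ^ (1 - σ₁ : ℂ) * ((π * y₂ : ℝ) : ℂ) ^ (1 - σ₂ : ℂ)
      = (((π ^ 3 * D) ^ ((1 - σ₁) / 2) : ℝ) : ℂ)
        * (((π * y₂) ^ ((1 - 2 * σ₂ + σ₁) / 2) : ℝ) : ℂ) := by
    rw [Complex.ofReal_cpow hDpos.le, Complex.ofReal_cpow hY.le, ofReal_cpow_eq_exp_log_mul hX,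
      ofReal_cpow_eq_exp_log_mul hY, ofReal_cpow_eq_exp_log_mul hDpos,
      ofReal_cpow_eq_exp_log_mul hY, hDlog, ← Complex.exp_add, ← Complex.exp_add]
    congr 1
    push_cast
    ring
  rw [hW, hconst]
  refine ⟨(hshear.integrable_comp_of_integrable hint).congr (.of_forall fun t => ?_), ?_⟩
  on_goal 2 => congr 1; refine integral_congr_ae (.of_forall fun t => ?_)
  all_goals
    simp only [Function.comp_apply]
    rw [mul_assoc _ _ (((π * y₂ : ℝ) : ℂ) ^ (-(Complex.I * (t.1 + t.2 : ℝ)))), hpow]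
    push_cast
    rw [show ((σ₂ : ℂ) + Complex.I * (t.1 + t.2) - γ) / 2 + ((σ₁ + γ) / 2 + Complex.I * t.1)
      = ((σ₁ : ℂ) + σ₂ + Complex.I * (t.2 + 3 * t.1)) / 2 by ring, add_comm (t.1 : ℂ) t.2]
    ring
end
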